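/- arXiv:1505.08169 — 5 statements merged into one kernel-verified Lean document; each statement's English description precedes it below -/
import Mathlib

section
/- Under the stated setup, for every set A of configurations ω : K → Bool and every h ∈ ℝ, the function g : ℝ → ℝ, g(h) = (μ (A^h)).toReal, is differentiable at every h with derivative g'(h) = − ∫_{A^h} (Σ_{x∈K} κ x · φ x) dμ(φ). (Margulis–Russo type formula for the Gaussian Gibbs measure, Proposition 3.2, via the finite-volume density representation.) -/
open MeasureTheory Real

/-- The level-set event `A^h = {φ | (1{h ≤ φ x})_x ∈ A}`. -/
def levSet {K : Type} (A : Set (K → Bool)) (h : ℝ) : Set (K → ℝ) :=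
  {φ | (fun x => decide (h ≤ φ x)) ∈ A}

theorem measurableSet_levSet {K : Type} [Fintype K] (A : Set (K → Bool)) (h : ℝ) :
    MeasurableSet (levSet A h) := by
  have hm : Measurable fun φ : K → ℝ => fun x => decide (h ≤ φ x) := by
    refine measurable_pi_lambda _ fun x => ?_
    refine measurable_to_bool ?_
    have : (fun φ : K → ℝ => decide (h ≤ φ x)) ⁻¹' {true} = {φ | h ≤ φ x} := by
      ext φ
      simp
    rw [this]
    exact measurableSet_le measurable_const (measurable_pi_apply x)
  exact hm (Set.toFinite A).measurableSet

/-- Translating the field by the constant `h` moves the level from `h` to `0`. -/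
theorem setIntegral_levSet_eq {K : Type} [Fintype K] (A : Set (K → Bool)) (h : ℝ)
    (F : (K → ℝ) → ℝ) :
    ∫ φ in levSet A h, F φ = ∫ φ in levSet A 0, F (φ + fun _ => h) := by
  rw [← integral_indicator (measurableSet_levSet A h),
    ← integral_indicator (measurableSet_levSet A 0),
    ← integral_add_right_eq_self _ (fun _ : K => h)]
  congr 1
  ext φ
  have : (φ + fun _ => h) ∈ levSet A h ↔ φ ∈ levSet A 0 := by
    refine iff_of_eq (congrArg (· ∈ A) (funext fun x => decide_eq_decide.mpr ?_))
    simp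
  by_cases hφ : φ ∈ levSet A 0 <;> simp [hφ, this]

theorem integrable_exp_neg_sum_mul_sq {K : Type} [Fintype K] (a : K → ℝ) (ha : ∀ x, 0 < a x) :
    Integrable fun φ : K → ℝ => Real.exp (-∑ x, a x * φ x ^ 2) := by
  have := Integrable.fintype_prod (𝕜 := ℝ) (μ := fun _ : K => (volume : Measure ℝ))
    (f := fun x t => Real.exp (-a x * t ^ 2)) fun x => integrable_exp_neg_mul_sq (ha x)
  refine this.congr (ae_of_all _ fun φ => ?_)
  simp [← Real.exp_sum, Finset.sum_neg_distrib]

theorem abs_sum_mul_mul_exp_le {K : Type} [Fintype K] (a : K → ℝ) (ha : ∀ x, 0 < a x)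
    (u : K → ℝ) :
    |∑ x, a x * u x| * Real.exp (-(∑ x, a x * u x ^ 2) / 2) ≤
      (∑ x, a x + 4) * Real.exp (-(∑ x, a x * u x ^ 2) / 4) := by
  set S := ∑ x, a x * u x ^ 2 with hS
  have hS0 : 0 ≤ S := Finset.sum_nonneg fun x _ => mul_nonneg (ha x).le (sq_nonneg _)
  have hM0 : 0 ≤ ∑ x, a x := Finset.sum_nonneg fun x _ => (ha x).le
  have h1 : |∑ x, a x * u x| ≤ ∑ x, a x + S := by
    rw [hS, ← Finset.sum_add_distrib]
    refine (Finset.abs_sum_le_sum_abs _ _).trans (Finset.sum_le_sum fun x _ => ?_)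
    rw [abs_mul, abs_of_pos (ha x)]
    have : |u x| ≤ 1 + u x ^ 2 := by
      rw [← sq_abs]
      nlinarith [sq_nonneg (|u x| - 1)]
    nlinarith [ha x]
  have h2 : ∑ x, a x + S ≤ (∑ x, a x + 4) * Real.exp (S / 4) := by
    nlinarith [Real.add_one_le_exp (S / 4)]
  calc _ ≤ ((∑ x, a x + 4) * Real.exp (S / 4)) * Real.exp (-S / 2) := by
        gcongr
        exact h1.trans h2
    _ = _ := by
        rw [mul_assoc, ← Real.exp_add]
        ring_nf

theorem exp_neg_sum_add_const_le {K : Type} [Fintype K] (a : K → ℝ) (ha : ∀ x, 0 < a x)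
    (φ : K → ℝ) {t T : ℝ} (ht : |t| ≤ T) :
    Real.exp (-(∑ x, a x * (φ x + t) ^ 2) / 4) ≤
      Real.exp ((∑ x, a x) * T ^ 2 / 4) * Real.exp (-∑ x, a x / 8 * φ x ^ 2) := by
  rw [← Real.exp_add, Real.exp_le_exp]
  have htT : t ^ 2 ≤ T ^ 2 := sq_le_sq' (by linarith [neg_abs_le t]) ((le_abs_self t).trans ht)
  have : ∑ x, a x / 8 * φ x ^ 2 ≤ ∑ x, (a x * (φ x + t) ^ 2 / 4 + a x * T ^ 2 / 4) := by
    refine Finset.sum_le_sum fun x _ => ?_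
    have : φ x ^ 2 / 2 ≤ (φ x + t) ^ 2 + T ^ 2 := by nlinarith [sq_nonneg (φ x + 2 * t)]
    nlinarith [ha x]
  rw [Finset.sum_add_distrib, ← Finset.sum_div, ← Finset.sum_div, ← Finset.sum_mul] at this
  linarith


/-- **Margulis–Russo type formula** (Proposition 3.2): for the ferromagnetic Gaussian Gibbs
measure `μ` with energy `E`, the function `h ↦ μ(A^h)` is differentiable with derivative
`- ∫_{A^h} Σ_x κ x · φ x dμ`. -/
theorem margulis_russo_gaussian
    (K : Type) [Fintype K] [Nonempty K]
    (c : K → K → ℝ) (hsym : ∀ x y, c x y = c y x) (hpos : ∀ x y, 0 ≤ c x y)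
    (κ : K → ℝ) (hκ : ∀ x, 0 < κ x)
    (E : (K → ℝ) → ℝ)
    (hE : ∀ φ : K → ℝ,
      E φ = (1 / 2) * ∑ x, ∑ y, c x y * (φ y - φ x) ^ 2 + ∑ x, κ x * (φ x) ^ 2)
    (Z : ℝ) (hZ : Z = ∫ φ : K → ℝ, Real.exp (-(E φ) / 2))
    (μ : Measure (K → ℝ))
    (hμ : μ = volume.withDensity fun φ => ENNReal.ofReal (Real.exp (-(E φ) / 2) / Z))
    (A : Set (K → Bool)) (h : ℝ) :
    HasDerivAt (fun h' : ℝ => (μ (levSet A h')).toReal)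
      (-(∫ φ in levSet A h, (∑ x, κ x * φ x) ∂μ)) h := by
  have hEκ : ∀ φ, ∑ x, κ x * φ x ^ 2 ≤ E φ := fun φ => by
    rw [hE]
    have : 0 ≤ ∑ x, ∑ y, c x y * (φ y - φ x) ^ 2 := Finset.sum_nonneg fun x _ =>
      Finset.sum_nonneg fun y _ => mul_nonneg (hpos x y) (sq_nonneg _)
    linarith
  have hEc : Continuous E := by
    rw [funext hE]
    fun_prop
  have hZ0 : 0 ≤ Z := hZ ▸ integral_nonneg fun φ => (Real.exp_pos _).le
  set f : (K → ℝ) → ℝ := fun φ => Real.exp (-(E φ) / 2) / Z with hf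
  have hfc : Continuous f := by fun_prop
  have hf0 : ∀ φ, 0 ≤ f φ := fun φ => div_nonneg (Real.exp_pos _).le hZ0
  have hμint : ∀ h' (G : (K → ℝ) → ℝ),
      ∫ φ in levSet A h', G φ ∂μ = ∫ φ in levSet A h', f φ * G φ := fun h' G => by
    rw [hμ, setIntegral_withDensity_eq_setIntegral_toReal_smul (by fun_prop)
      (ae_of_all _ fun _ => ENNReal.ofReal_lt_top) _ (measurableSet_levSet A h')]
    refine integral_congr_ae (ae_of_all _ fun φ => ?_)
    exact congrArg (· * G φ) (ENNReal.toReal_ofReal (hf0 φ))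
  have hlhs : (fun h' : ℝ => (μ (levSet A h')).toReal) =
      fun h' => ∫ φ in levSet A 0, f (φ + fun _ => h') := by
    ext h'
    rw [← setIntegral_levSet_eq A h' f]
    have := hμint h' fun _ => 1
    simpa [Measure.real] using this
  have hderiv : ∀ φ t, HasDerivAt (fun t : ℝ => f (φ + fun _ => t))
      (-(f (φ + fun _ => t) * ∑ x, κ x * (φ x + t))) t := fun φ t => by
    have hEd : HasDerivAt (fun t : ℝ => E (φ + fun _ => t))
        (∑ x, κ x * (2 * (φ x + t))) t := by
      simp only [hE, Pi.add_apply, add_sub_add_right_eq_sub]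
      refine HasDerivAt.const_add _ (HasDerivAt.fun_sum fun x _ => HasDerivAt.const_mul _ ?_)
      simpa using ((hasDerivAt_id t).const_add (φ x)).fun_pow 2
    refine ((hEd.fun_neg.div_const 2).exp.div_const Z).congr_deriv ?_
    have : ∑ x, κ x * (2 * (φ x + t)) = 2 * ∑ x, κ x * (φ x + t) := by
      rw [Finset.mul_sum]
      exact Finset.sum_congr rfl fun x _ => by ring
    rw [this]
    simp only [hf]
    ring
  have hfle : ∀ φ, f φ ≤ Real.exp (-(∑ x, κ x * φ x ^ 2) / 2) / Z := fun φ => by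
    simp only [hf]
    gcongr
    exact hEκ φ
  have hfint : Integrable f := by
    refine ((integrable_exp_neg_sum_mul_sq (fun x => κ x / 2)
      fun x => half_pos (hκ x)).div_const Z).mono' hfc.aestronglyMeasurable
      (ae_of_all _ fun φ => ?_)
    rw [Real.norm_of_nonneg (hf0 φ)]
    convert hfle φ using 3
    rw [neg_div, Finset.sum_div]
    exact congrArg _ (Finset.sum_congr rfl fun x _ => by ring)
  rw [hlhs, hμint, setIntegral_levSet_eq, ← integral_neg]
  refine (hasDerivAt_integral_of_dominated_loc_of_deriv_le
    (F' := fun t φ => -(f (φ + fun _ => t) * ∑ x, κ x * (φ x + t)))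
    (bound := fun φ => (∑ x, κ x + 4) * Real.exp ((∑ x, κ x) * (|h| + 1) ^ 2 / 4) / Z *
      Real.exp (-∑ x, κ x / 8 * φ x ^ 2))
    (Metric.ball_mem_nhds h one_pos) ?_ ?_ ?_ ?_ ?_ ?_).2
  · exact Filter.Eventually.of_forall fun t => Continuous.aestronglyMeasurable (by fun_prop)
  · exact (hfint.comp_add_right _).integrableOn
  · exact Continuous.aestronglyMeasurable (by fun_prop)
  · refine ae_of_all _ fun φ t ht => ?_
    have hM0 : 0 ≤ ∑ x, κ x := Finset.sum_nonneg fun x _ => (hκ x).le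
    have htT : |t| ≤ |h| + 1 := by
      have h1 : |t - h| < 1 := by simpa [Real.dist_eq] using ht
      linarith [abs_sub_abs_le_abs_sub t h]
    rw [norm_neg, norm_mul, Real.norm_of_nonneg (hf0 _), Real.norm_eq_abs]
    calc f (φ + fun _ => t) * |∑ x, κ x * (φ x + t)|
        ≤ Real.exp (-(∑ x, κ x * (φ x + t) ^ 2) / 2) / Z * |∑ x, κ x * (φ x + t)| := by
          gcongr
          exact hfle _
      _ = |∑ x, κ x * (φ x + t)| * Real.exp (-(∑ x, κ x * (φ x + t) ^ 2) / 2) / Z := by ring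
      _ ≤ (∑ x, κ x + 4) * Real.exp (-(∑ x, κ x * (φ x + t) ^ 2) / 4) / Z := by
          refine div_le_div_of_nonneg_right ?_ hZ0
          exact abs_sum_mul_mul_exp_le κ hκ fun x => φ x + t
      _ ≤ (∑ x, κ x + 4) * (Real.exp ((∑ x, κ x) * (|h| + 1) ^ 2 / 4) *
            Real.exp (-∑ x, κ x / 8 * φ x ^ 2)) / Z := by
          gcongr
          exact exp_neg_sum_add_const_le κ hκ φ htT
      _ = _ := by ring
  · exact ((integrable_exp_neg_sum_mul_sq (fun x => κ x / 8)
      fun x => div_pos (hκ x) (by norm_num)).const_mul _).integrableOn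
  · exact ae_of_all _ fun φ t _ => hderiv φ t
end

section
/- Under the stated setup, for every height profile 𝐡 : K → ℝ, the law Q of the level-set configuration satisfies the FKG lattice condition: for all ω, ω' : K → Bool, Q(ω ∨ ω') · Q(ω ∧ ω') ≥ Q(ω) · Q(ω'), where Q(ω) := μ({φ : K → ℝ | ∀ x ∈ K, (𝐡 x ≤ φ x ↔ ω x = true)}) and ω ∨ ω', ω ∧ ω' denote the pointwise maximum and minimum (with false < true). -/
open MeasureTheory Real

lemma ENNReal.add_le_add_of_mul_le_mul {a b c d : ENNReal} (ha : a ≤ c) (hb : b ≤ c)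
    (h : a * b ≤ c * d) : a + b ≤ c + d := by
  rcases eq_or_ne c ⊤ with rfl | hc
  · simp
  rcases eq_or_ne c 0 with rfl | hc0
  · simp_all
  rcases eq_or_ne d ⊤ with rfl | hd
  · simp
  lift a to NNReal using ne_top_of_le_ne_top hc ha
  lift b to NNReal using ne_top_of_le_ne_top hc hb
  lift c to NNReal using hc
  lift d to NNReal using hd
  norm_cast at *
  have hc' : (0 : ℝ) < c := by exact_mod_cast pos_iff_ne_zero.mpr hc0
  rw [← NNReal.coe_le_coe] at *
  push_cast at *
  refine le_of_mul_le_mul_left ?_ hc'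
  nlinarith [mul_nonneg (sub_nonneg.mpr ha) (sub_nonneg.mpr hb)]

/-- The four functions theorem on a linear order with an s-finite measure. -/
lemma lintegral_mul_lintegral_le_of_sup_inf {α : Type*} [LinearOrder α] [MeasurableSpace α]
    {μ : Measure α} [SFinite μ] {f₁ f₂ f₃ f₄ : α → ENNReal} (h₁ : Measurable f₁)
    (h₂ : Measurable f₂) (h₃ : Measurable f₃) (h₄ : Measurable f₄)
    (h : ∀ x y, f₁ x * f₂ y ≤ f₃ (x ⊔ y) * f₄ (x ⊓ y)) :
    (∫⁻ x, f₁ x ∂μ) * ∫⁻ x, f₂ x ∂μ ≤ (∫⁻ x, f₃ x ∂μ) * ∫⁻ x, f₄ x ∂μ := by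
  have key : ∀ x y, x ≤ y → f₁ x * f₂ y + f₁ y * f₂ x ≤ f₃ x * f₄ y + f₃ y * f₄ x := by
    intro x y hxy
    rw [add_comm (f₃ x * f₄ y)]
    refine ENNReal.add_le_add_of_mul_le_mul (by simpa [hxy] using h x y)
      (by simpa [hxy] using h y x) ?_
    calc f₁ x * f₂ y * (f₁ y * f₂ x) = (f₁ x * f₂ x) * (f₁ y * f₂ y) := by ring
      _ ≤ (f₃ x * f₄ x) * (f₃ y * f₄ y) :=
        mul_le_mul' (by simpa using h x x) (by simpa using h y y)
      _ = _ := by ring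
  have symmetrize : ∀ f g : α → ENNReal, Measurable f → Measurable g →
      ∫⁻ x, ∫⁻ y, f x * g y + f y * g x ∂μ ∂μ = 2 * ((∫⁻ x, f x ∂μ) * ∫⁻ x, g x ∂μ) := by
    intro f g hf hg
    have (x : α) : ∫⁻ y, f x * g y + f y * g x ∂μ
        = f x * ∫⁻ y, g y ∂μ + (∫⁻ y, f y ∂μ) * g x := by
      rw [lintegral_add_left (by fun_prop), lintegral_const_mul _ hg, lintegral_mul_const _ hf]
    simp_rw [this]
    rw [lintegral_add_left (by fun_prop), lintegral_const_mul _ hg, lintegral_mul_const _ hf]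
    ring
  rw [← ENNReal.mul_le_mul_iff_right two_ne_zero ENNReal.ofNat_ne_top, ← symmetrize _ _ h₁ h₂,
    ← symmetrize _ _ h₃ h₄]
  refine lintegral_mono fun x => lintegral_mono fun y => ?_
  rcases le_total x y with hxy | hxy
  · exact key x y hxy
  · simpa only [add_comm] using key y x hxy

/-- The four functions theorem for marginals of a product of s-finite measures. -/
lemma lmarginal_mul_lmarginal_le_of_sup_inf {ι : Type*} [DecidableEq ι] {α : ι → Type*}
    [∀ i, LinearOrder (α i)] [∀ i, MeasurableSpace (α i)] {μ : ∀ i, Measure (α i)}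
    [∀ i, SigmaFinite (μ i)] {f₁ f₂ f₃ f₄ : (∀ i, α i) → ENNReal} (h₁ : Measurable f₁)
    (h₂ : Measurable f₂) (h₃ : Measurable f₃) (h₄ : Measurable f₄)
    (h : ∀ x y, f₁ x * f₂ y ≤ f₃ (x ⊔ y) * f₄ (x ⊓ y)) (s : Finset ι) (x y : ∀ i, α i) :
    lmarginal μ s f₁ x * lmarginal μ s f₂ y
      ≤ lmarginal μ s f₃ (x ⊔ y) * lmarginal μ s f₄ (x ⊓ y) := by
  induction s using Finset.induction_on generalizing x y with
  | empty => simpa using h x y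
  | insert i s hi ih =>
    rw [lmarginal_insert _ h₁ hi, lmarginal_insert _ h₂ hi, lmarginal_insert _ h₃ hi,
      lmarginal_insert _ h₄ hi]
    have meas {f : (∀ i, α i) → ENNReal} (hf : Measurable f) (z : ∀ i, α i) :
        Measurable fun t => lmarginal μ s f (Function.update z i t) :=
      (hf.lmarginal μ).comp (measurable_update z)
    refine lintegral_mul_lintegral_le_of_sup_inf (meas h₁ x) (meas h₂ y) (meas h₃ _)
      (meas h₄ _) fun a b => ?_
    have hsup : Function.update (x ⊔ y) i (a ⊔ b)
        = Function.update x i a ⊔ Function.update y i b :=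
      funext fun j => by rcases eq_or_ne j i with rfl | hj <;> simp [*]
    have hinf : Function.update (x ⊓ y) i (a ⊓ b)
        = Function.update x i a ⊓ Function.update y i b :=
      funext fun j => by rcases eq_or_ne j i with rfl | hj <;> simp [*]
    rw [hsup, hinf]
    exact ih _ _

/-- The four functions theorem for a finite product of σ-finite measures. -/
lemma lintegral_pi_mul_lintegral_pi_le_of_sup_inf {ι : Type*} [Fintype ι] {α : ι → Type*}
    [∀ i, LinearOrder (α i)] [∀ i, MeasurableSpace (α i)] {μ : ∀ i, Measure (α i)}
    [∀ i, SigmaFinite (μ i)] {f₁ f₂ f₃ f₄ : (∀ i, α i) → ENNReal} (h₁ : Measurable f₁)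
    (h₂ : Measurable f₂) (h₃ : Measurable f₃) (h₄ : Measurable f₄)
    (h : ∀ x y, f₁ x * f₂ y ≤ f₃ (x ⊔ y) * f₄ (x ⊓ y)) :
    (∫⁻ x, f₁ x ∂Measure.pi μ) * ∫⁻ x, f₂ x ∂Measure.pi μ
      ≤ (∫⁻ x, f₃ x ∂Measure.pi μ) * ∫⁻ x, f₄ x ∂Measure.pi μ := by
  classical
  rcases isEmpty_or_nonempty (∀ i, α i) with hα | ⟨⟨x⟩⟩
  · simp
  have := lmarginal_mul_lmarginal_le_of_sup_inf (μ := μ) h₁ h₂ h₃ h₄ h Finset.univ x x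
  simpa only [lmarginal_univ] using this

lemma sq_sub_sup_add_sq_sub_inf_le (a b a' b' : ℝ) :
    (a ⊔ b - a' ⊔ b') ^ 2 + (a ⊓ b - a' ⊓ b') ^ 2 ≤ (a - a') ^ 2 + (b - b') ^ 2 := by
  rcases le_total a b with h | h <;> rcases le_total a' b' with h' | h' <;>
    simp only [h, h', sup_of_le_left, sup_of_le_right, inf_of_le_left, inf_of_le_right] <;>
    nlinarith [mul_nonneg (sub_nonneg.mpr h) (sub_nonneg.mpr h')]

/-- The Dirichlet energy with nonnegative conductances and a mass term is submodular. -/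
lemma energy_sup_add_energy_inf_le {K : Type*} [Fintype K] {c : K → K → ℝ}
    (hc : ∀ x y, 0 ≤ c x y) (κ φ ψ : K → ℝ) :
    ((1 / 2) * ∑ x, ∑ y, c x y * ((φ ⊔ ψ) y - (φ ⊔ ψ) x) ^ 2 + ∑ x, κ x * ((φ ⊔ ψ) x) ^ 2)
      + ((1 / 2) * ∑ x, ∑ y, c x y * ((φ ⊓ ψ) y - (φ ⊓ ψ) x) ^ 2
        + ∑ x, κ x * ((φ ⊓ ψ) x) ^ 2)
      ≤ ((1 / 2) * ∑ x, ∑ y, c x y * (φ y - φ x) ^ 2 + ∑ x, κ x * (φ x) ^ 2)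
        + ((1 / 2) * ∑ x, ∑ y, c x y * (ψ y - ψ x) ^ 2 + ∑ x, κ x * (ψ x) ^ 2) := by
  have hgrad : ∑ x, ∑ y, c x y * ((φ ⊔ ψ) y - (φ ⊔ ψ) x) ^ 2
      + ∑ x, ∑ y, c x y * ((φ ⊓ ψ) y - (φ ⊓ ψ) x) ^ 2
      ≤ ∑ x, ∑ y, c x y * (φ y - φ x) ^ 2 + ∑ x, ∑ y, c x y * (ψ y - ψ x) ^ 2 := by
    simp only [← Finset.sum_add_distrib, ← mul_add]
    exact Finset.sum_le_sum fun x _ => Finset.sum_le_sum fun y _ =>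
      mul_le_mul_of_nonneg_left (sq_sub_sup_add_sq_sub_inf_le _ _ _ _) (hc x y)
  have hmass : ∑ x, κ x * ((φ ⊔ ψ) x) ^ 2 + ∑ x, κ x * ((φ ⊓ ψ) x) ^ 2
      = ∑ x, κ x * (φ x) ^ 2 + ∑ x, κ x * (ψ x) ^ 2 := by
    simp only [← Finset.sum_add_distrib, ← mul_add]
    refine Finset.sum_congr rfl fun x _ => ?_
    rcases le_total (φ x) (ψ x) with h | h <;> simp [h, add_comm]
  linarith

/-- **FKG lattice condition for the level-set law** (Remark 2.5): the law `Q` of the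
level-set configuration `ξ^hprof` under the ferromagnetic Gaussian Gibbs measure satisfies
`Q(ω ∨ ω') · Q(ω ∧ ω') ≥ Q(ω) · Q(ω')`. -/
theorem fkg_lattice_condition_level_sets
    (K : Type) [Fintype K] [Nonempty K]
    (c : K → K → ℝ) (hsym : ∀ x y, c x y = c y x) (hpos : ∀ x y, 0 ≤ c x y)
    (κ : K → ℝ) (hκ : ∀ x, 0 < κ x)
    (E : (K → ℝ) → ℝ)
    (hE : ∀ φ : K → ℝ,
      E φ = (1 / 2) * ∑ x, ∑ y, c x y * (φ y - φ x) ^ 2 + ∑ x, κ x * (φ x) ^ 2)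
    (Z : ℝ) (hZ : Z = ∫ φ : K → ℝ, Real.exp (-(E φ) / 2))
    (μ : Measure (K → ℝ))
    (hμ : μ = volume.withDensity fun φ => ENNReal.ofReal (Real.exp (-(E φ) / 2) / Z))
    (hprof : K → ℝ)
    (Q : (K → Bool) → ENNReal)
    (hQ : ∀ ω : K → Bool, Q ω = μ {φ : K → ℝ | ∀ x : K, (hprof x ≤ φ x ↔ ω x = true)})
    (ω ω' : K → Bool) :
    Q ω * Q ω' ≤ Q (fun x => ω x || ω' x) * Q (fun x => ω x && ω' x) := by
  have hZ0 : 0 ≤ Z := hZ ▸ integral_nonneg fun φ => (exp_pos _).le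
  have hEm : Measurable E := by
    rw [funext hE]
    fun_prop
  set d : (K → ℝ) → ENNReal := fun φ => ENNReal.ofReal (Real.exp (-(E φ) / 2) / Z) with hd
  have hdm : Measurable d := by fun_prop
  set A : (K → Bool) → Set (K → ℝ) := fun ω => {φ | ∀ x, (hprof x ≤ φ x ↔ ω x = true)} with hA
  have hAm (ω : K → Bool) : MeasurableSet (A ω) := by
    simp only [hA, Set.ofPred_forall]
    exact MeasurableSet.iInter fun x =>
      (measurableSet_le measurable_const (measurable_pi_apply x)).iff (.const _)
  have hQd (ω : K → Bool) : Q ω = ∫⁻ φ, (A ω).indicator d φ ∂Measure.pi fun _ => volume := by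
    rw [hQ, hμ, withDensity_apply _ (hAm ω), lintegral_indicator (hAm ω), volume_pi]
  have hdd (φ ψ : K → ℝ) : d φ * d ψ ≤ d (φ ⊔ ψ) * d (φ ⊓ ψ) := by
    simp only [hd]
    rw [← ENNReal.ofReal_mul (by positivity), ← ENNReal.ofReal_mul (by positivity),
      div_mul_div_comm, div_mul_div_comm, ← exp_add, ← exp_add]
    have := energy_sup_add_energy_inf_le hpos κ φ ψ
    simp only [← hE] at this
    gcongr ENNReal.ofReal (exp ?_ / _)
    linarith
  simp only [hQd]
  refine lintegral_pi_mul_lintegral_pi_le_of_sup_inf (hdm.indicator (hAm _))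
    (hdm.indicator (hAm _)) (hdm.indicator (hAm _)) (hdm.indicator (hAm _)) fun φ ψ => ?_
  by_cases hφ : φ ∈ A ω
  swap
  · simp [hφ]
  by_cases hψ : ψ ∈ A ω'
  swap
  · simp [hψ]
  have hsup : φ ⊔ ψ ∈ A fun x => ω x || ω' x := fun x => by simp [← hφ x, ← hψ x]
  have hinf : φ ⊓ ψ ∈ A fun x => ω x && ω' x := fun x => by simp [← hφ x, ← hψ x]
  simpa only [Set.indicator_of_mem, hφ, hψ, hsup, hinf] using hdd φ ψ
end

section
/- Let K be a finite type, c : K → K → ℝ symmetric with c x y ≥ 0, κ : K → ℝ, and E(φ) = (1/2)·Σ_{x,y∈K} c x y·(φ y − φ x)² + Σ_{x∈K} κ x·(φ x)². Let λ > 0, 𝐡 : K → ℝ, let O, C ⊆ K be disjoint, and let x ∈ C. Define V₊(t) = max(−t, 0) and V₋(t) = max(t, 0), and for φ : K → ℝ set H^±(φ) = E(φ) + λ·[ Σ_{y∈O} V₊(φ y − 𝐡 y) + Σ_{z∈C, z≠x} V₋(φ z − 𝐡 z) + V_±(φ x − 𝐡 x) ] (with V₊ at x for H⁺ and V₋ at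 x for H⁻). Then for all φ, φ' : K → ℝ, H⁺(φ ∨ φ') + H⁻(φ ∧ φ') ≤ H⁺(φ) + H⁻(φ'), where ∨ and ∧ denote the pointwise maximum and minimum. (Holley condition for the perturbed Hamiltonians, equation (2.20) of the paper.) -/
open MeasureTheory Real

theorem sum_apply_max_add_sum_apply_min {ι α β : Type*} [LinearOrder α] [AddCommMonoid β]
    (s : Finset ι) (f : ι → α → β) (φ ψ : ι → α) :
    ∑ i ∈ s, f i (max (φ i) (ψ i)) + ∑ i ∈ s, f i (min (φ i) (ψ i))
      = ∑ i ∈ s, f i (φ i) + ∑ i ∈ s, f i (ψ i) := by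
  simp only [← Finset.sum_add_distrib, fn_max_add_fn_min]

theorem sq_max_sub_max_add_sq_min_sub_min_le (a b p q : ℝ) :
    (max a b - max p q) ^ 2 + (min a b - min p q) ^ 2 ≤ (a - p) ^ 2 + (b - q) ^ 2 := by
  rcases le_total a b with h | h <;> rcases le_total p q with h' | h' <;>
    simp only [max_eq_left, max_eq_right, min_eq_left, min_eq_right, h, h'] <;>
    nlinarith [mul_nonneg (sub_nonneg.2 h) (sub_nonneg.2 h')]

theorem sum_weighted_sq_sub_max_add_min_le {ι : Type*} [Fintype ι] (c : ι → ι → ℝ)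
    (hc : ∀ i j, 0 ≤ c i j) (φ ψ : ι → ℝ) :
    ∑ i, ∑ j, c i j * (max (φ j) (ψ j) - max (φ i) (ψ i)) ^ 2
        + ∑ i, ∑ j, c i j * (min (φ j) (ψ j) - min (φ i) (ψ i)) ^ 2
      ≤ ∑ i, ∑ j, c i j * (φ j - φ i) ^ 2 + ∑ i, ∑ j, c i j * (ψ j - ψ i) ^ 2 := by
  simp only [← Finset.sum_add_distrib, ← mul_add]
  exact Finset.sum_le_sum fun i _ => Finset.sum_le_sum fun j _ =>
    mul_le_mul_of_nonneg_left (sq_max_sub_max_add_sq_min_sub_min_le _ _ _ _) (hc i j)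

theorem apply_max_add_apply_min_le_of_antitone_monotone {α : Type*} [LinearOrder α] {f g : α → ℝ}
    (hf : Antitone f) (hg : Monotone g) (a b : α) :
    f (max a b) + g (min a b) ≤ f a + g b :=
  add_le_add (hf (le_max_left a b)) (hg (min_le_right a b))

/-- **Holley condition for the perturbed Hamiltonians** (equation (2.20)):
`H⁺(φ ∨ φ') + H⁻(φ ∧ φ') ≤ H⁺(φ) + H⁻(φ')`. -/
theorem holley_condition_perturbed_hamiltonians
    (K : Type) [Fintype K] [DecidableEq K]
    (c : K → K → ℝ) (hsym : ∀ x y, c x y = c y x) (hpos : ∀ x y, 0 ≤ c x y)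
    (κ : K → ℝ)
    (E : (K → ℝ) → ℝ)
    (hE : ∀ φ : K → ℝ,
      E φ = (1 / 2) * ∑ x, ∑ y, c x y * (φ y - φ x) ^ 2 + ∑ x, κ x * (φ x) ^ 2)
    (lam : ℝ) (hlam : 0 < lam)
    (hprof : K → ℝ)
    (O C : Finset K) (hOC : Disjoint O C) (x : K) (hx : x ∈ C)
    (Vp Vm : ℝ → ℝ)
    (hVp : ∀ t : ℝ, Vp t = max (-t) 0) (hVm : ∀ t : ℝ, Vm t = max t 0)
    (Hp Hm : (K → ℝ) → ℝ)
    (hHp : ∀ φ : K → ℝ, Hp φ = E φ + lam *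
      ((∑ y ∈ O, Vp (φ y - hprof y)) + (∑ z ∈ C.erase x, Vm (φ z - hprof z))
        + Vp (φ x - hprof x)))
    (hHm : ∀ φ : K → ℝ, Hm φ = E φ + lam *
      ((∑ y ∈ O, Vp (φ y - hprof y)) + (∑ z ∈ C.erase x, Vm (φ z - hprof z))
        + Vm (φ x - hprof x))) :
    ∀ φ φ' : K → ℝ,
      Hp (fun y => max (φ y) (φ' y)) + Hm (fun y => min (φ y) (φ' y)) ≤ Hp φ + Hm φ' := by
  intro φ φ'
  have hgrad := sum_weighted_sq_sub_max_add_min_le c hpos φ φ'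
  have hmass := sum_apply_max_add_sum_apply_min Finset.univ (fun y t => κ y * t ^ 2) φ φ'
  have hpot := add_le_add
    (add_le_add (sum_apply_max_add_sum_apply_min O (fun y t => Vp (t - hprof y)) φ φ').le
      (sum_apply_max_add_sum_apply_min (C.erase x) (fun z t => Vm (t - hprof z)) φ φ').le)
    (apply_max_add_apply_min_le_of_antitone_monotone (f := fun t => Vp (t - hprof x))
      (g := fun t => Vm (t - hprof x))
      (fun s t h => by simp only [hVp]; gcongr) (fun s t h => by simp only [hVm]; gcongr)
      (φ x) (φ' x))
  have hlampot := mul_le_mul_of_nonneg_left hpot hlam.le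
  simp only [hHp, hHm, hE]
  linarith
end

section
/- Let K be a finite type, c : K → K → ℝ symmetric with c x y ≥ 0 for all x, y, and κ : K → ℝ. Define E(φ) = (1/2)·Σ_{x,y∈K} c x y·(φ y − φ x)² + Σ_{x∈K} κ x·(φ x)² for φ : K → ℝ. Then E is submodular: for all φ, ψ : K → ℝ, E(φ ∨ ψ) + E(φ ∧ ψ) ≤ E(φ) + E(ψ), where ∨ and ∧ denote the pointwise maximum and minimum. -/
open MeasureTheory Real

theorem sq_max_add_sq_min (a b : ℝ) : max a b ^ 2 + min a b ^ 2 = a ^ 2 + b ^ 2 := by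
  rcases le_total a b with h | h <;> simp [h, add_comm]

theorem sq_sub_max_add_sq_sub_min_le (a b a' b' : ℝ) :
    (max a' b' - max a b) ^ 2 + (min a' b' - min a b) ^ 2 ≤ (a' - a) ^ 2 + (b' - b) ^ 2 := by
  rcases le_total a b with h | h <;> rcases le_total a' b' with h' | h' <;> simp only [h, h',
    max_eq_left, max_eq_right, min_eq_left, min_eq_right] <;>
    nlinarith [mul_nonneg (sub_nonneg.2 h) (sub_nonneg.2 h')]

/-- **Submodularity of the Gaussian energy**: for symmetric nonnegative conductances,
`E(φ ∨ ψ) + E(φ ∧ ψ) ≤ E(φ) + E(ψ)`. -/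
theorem energy_submodular
    (K : Type) [Fintype K]
    (c : K → K → ℝ) (hsym : ∀ x y, c x y = c y x) (hpos : ∀ x y, 0 ≤ c x y)
    (κ : K → ℝ)
    (E : (K → ℝ) → ℝ)
    (hE : ∀ φ : K → ℝ,
      E φ = (1 / 2) * ∑ x, ∑ y, c x y * (φ y - φ x) ^ 2 + ∑ x, κ x * (φ x) ^ 2) :
    ∀ φ ψ : K → ℝ,
      E (fun y => max (φ y) (ψ y)) + E (fun y => min (φ y) (ψ y)) ≤ E φ + E ψ := by
  intro φ ψ
  have hedge : ∑ x, ∑ y, c x y * (max (φ y) (ψ y) - max (φ x) (ψ x)) ^ 2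
      + ∑ x, ∑ y, c x y * (min (φ y) (ψ y) - min (φ x) (ψ x)) ^ 2
      ≤ ∑ x, ∑ y, c x y * (φ y - φ x) ^ 2 + ∑ x, ∑ y, c x y * (ψ y - ψ x) ^ 2 := by
    simp only [← Finset.sum_add_distrib, ← mul_add]
    exact Finset.sum_le_sum fun x _ => Finset.sum_le_sum fun y _ =>
      mul_le_mul_of_nonneg_left (sq_sub_max_add_sq_sub_min_le _ _ _ _) (hpos x y)
  have hmass : ∑ x, κ x * max (φ x) (ψ x) ^ 2 + ∑ x, κ x * min (φ x) (ψ x) ^ 2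
      = ∑ x, κ x * φ x ^ 2 + ∑ x, κ x * ψ x ^ 2 := by
    simp only [← Finset.sum_add_distrib, ← mul_add, sq_max_add_sq_min]
  simp only [hE]
  linarith
end

section
/- There exists a universal constant c > 0 with the following property. For every nonempty finite type K, every probability measure Q on K → Bool such that Q({ω}) > 0 for all ω and Q satisfies the FKG lattice condition Q({ω ∨ ω'})·Q({ω ∧ ω'}) ≥ Q({ω})·Q({ω'}) for all ω, ω', and every increasing set A ⊆ (K → Bool), one has max_{x∈K} I_Q(A, x) ≥ c · Q(A)·(1 − Q(A)) · (log |K|) / |K|. (ℓ^∞ influence theorem, Theorem 4.1, equation (4.3).) -/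
open MeasureTheory

/-- The conditional influence of a site `x` on the event `A`, for a probability
measure `Q` on configurations `K → Bool`. -/
noncomputable def condInfluenceBool {K : Type} (Q : Measure (K → Bool))
    (A : Set (K → Bool)) (x : K) : ℝ :=
  (Q (A ∩ {ω | ω x = true})).toReal / (Q {ω | ω x = true}).toReal
    - (Q (A ∩ {ω | ω x = false})).toReal / (Q {ω | ω x = false}).toReal

section Entropy

open Finset

/-- Two-point logarithmic Sobolev inequality, for unnormalised weights. -/
lemma two_point_entropy_le {W₁ W₂ S₁ S₂ : ℝ} (hW₁ : 0 < W₁) (hW₂ : 0 < W₂) (hS₁ : 0 ≤ S₁)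
    (hS₂ : 0 ≤ S₂) :
    S₁ * (Real.log S₁ - Real.log W₁) + S₂ * (Real.log S₂ - Real.log W₂)
      - (S₁ + S₂) * (Real.log (S₁ + S₂) - Real.log (W₁ + W₂))
      ≤ (W₁ + W₂) * (√(S₁ / W₁) - √(S₂ / W₂)) ^ 2 := by
  rcases (add_nonneg hS₁ hS₂).eq_or_lt with h0 | hS
  · have h1 : S₁ = 0 := by linarith
    have h2 : S₂ = 0 := by linarith
    subst h1 h2
    simp
  have key : ∀ S W : ℝ, 0 ≤ S → 0 < W →
      S * (Real.log S - Real.log W) - S * (Real.log (S₁ + S₂) - Real.log (W₁ + W₂))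
        ≤ S * (S / W * ((W₁ + W₂) / (S₁ + S₂)) - 1) := by
    intro S W hS0 hW
    rcases hS0.eq_or_lt with rfl | hS'
    · simp
    rw [← mul_sub]
    refine mul_le_mul_of_nonneg_left ?_ hS0
    have hpos : 0 < S / W * ((W₁ + W₂) / (S₁ + S₂)) := by positivity
    have := Real.log_le_sub_one_of_pos hpos
    rw [Real.log_mul (by positivity) (by positivity), Real.log_div (by positivity) (by positivity),
      Real.log_div (by positivity) (by positivity)] at this
    linarith
  have k1 := key S₁ W₁ hS₁ hW₁
  have k2 := key S₂ W₂ hS₂ hW₂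
  obtain ⟨a, ha⟩ : ∃ a, a = √(S₁ / W₁) := ⟨_, rfl⟩
  obtain ⟨b, hb⟩ : ∃ b, b = √(S₂ / W₂) := ⟨_, rfl⟩
  have ha2 : S₁ = W₁ * a ^ 2 := by
    rw [ha, Real.sq_sqrt (by positivity)]; field_simp
  have hb2 : S₂ = W₂ * b ^ 2 := by
    rw [hb, Real.sq_sqrt (by positivity)]; field_simp
  rw [← ha, ← hb]
  have main : S₁ * (S₁ / W₁ * ((W₁ + W₂) / (S₁ + S₂)) - 1)
      + S₂ * (S₂ / W₂ * ((W₁ + W₂) / (S₁ + S₂)) - 1) ≤ (W₁ + W₂) * (a - b) ^ 2 := by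
    have e : S₁ * (S₁ / W₁ * ((W₁ + W₂) / (S₁ + S₂)) - 1)
      + S₂ * (S₂ / W₂ * ((W₁ + W₂) / (S₁ + S₂)) - 1)
        = W₁ * W₂ * (a ^ 2 - b ^ 2) ^ 2 / (S₁ + S₂) := by
      have hS' := hS.ne'
      rw [ha2, hb2] at hS' ⊢
      field_simp
      ring
    rw [e, div_le_iff₀ hS, ha2, hb2]
    have : 0 ≤ (a - b) ^ 2 * (W₁ * a - W₂ * b) ^ 2 := by positivity
    nlinarith [this]
  linarith

variable {α : Type*}

/-- The entropy of `h` with respect to the (unnormalised) weights `w` on the finite set `s`. -/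
noncomputable def entOn (s : Finset α) (w h : α → ℝ) : ℝ :=
  ∑ a ∈ s, w a * (h a * Real.log (h a))
    - (∑ a ∈ s, w a * h a) * (Real.log (∑ a ∈ s, w a * h a) - Real.log (∑ a ∈ s, w a))

/-- The distance between the `L²` norms of `f` and `g` is at most that of `f` and `g`. -/
lemma sqrt_sub_sqrt_sq_le (s t : Finset α) (w g : α → ℝ) (hw : ∀ a, 0 < w a) (hs : s.Nonempty)
    (ht : t.Nonempty) :
    (√((∑ a ∈ s, w a * g a ^ 2) / ∑ a ∈ s, w a)
        - √((∑ a ∈ t, w a * g a ^ 2) / ∑ a ∈ t, w a)) ^ 2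
      ≤ (∑ a ∈ s, ∑ b ∈ t, w a * w b * (g a - g b) ^ 2)
        / ((∑ a ∈ s, w a) * ∑ a ∈ t, w a) := by
  have hWs : 0 < ∑ a ∈ s, w a := sum_pos (fun a _ => hw a) hs
  have hWt : 0 < ∑ a ∈ t, w a := sum_pos (fun a _ => hw a) ht
  have cs : ∀ r : Finset α, r.Nonempty → |(∑ a ∈ r, w a * g a) / ∑ a ∈ r, w a|
      ≤ √((∑ a ∈ r, w a * g a ^ 2) / ∑ a ∈ r, w a) := by
    intro r hr
    have hWr : 0 < ∑ a ∈ r, w a := sum_pos (fun a _ => hw a) hr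
    apply Real.abs_le_sqrt
    have h := Finset.sum_sq_le_sum_mul_sum_of_sq_le_mul r (r := fun a => w a * g a)
      (f := w) (g := fun a => w a * g a ^ 2)
      (fun a _ => (hw a).le) (fun a _ => mul_nonneg (hw a).le (sq_nonneg _))
      (fun a _ => le_of_eq (by ring))
    rw [div_pow, div_le_div_iff₀ (by positivity) hWr]
    nlinarith
  have e : (∑ a ∈ s, ∑ b ∈ t, w a * w b * (g a - g b) ^ 2)
      = (∑ a ∈ s, w a * g a ^ 2) * (∑ a ∈ t, w a) + (∑ a ∈ s, w a) * (∑ a ∈ t, w a * g a ^ 2)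
        - 2 * ((∑ a ∈ s, w a * g a) * (∑ a ∈ t, w a * g a)) := by
    rw [sum_mul_sum, sum_mul_sum, sum_mul_sum, mul_sum, ← sum_add_distrib, ← sum_sub_distrib]
    refine sum_congr rfl fun a _ => ?_
    rw [mul_sum, ← sum_add_distrib, ← sum_sub_distrib]
    refine sum_congr rfl fun b _ => ?_
    ring
  have h1 := cs s hs
  have h2 := cs t ht
  have hn1 : 0 ≤ (∑ a ∈ s, w a * g a ^ 2) / ∑ a ∈ s, w a :=
    div_nonneg (sum_nonneg fun a _ => mul_nonneg (hw a).le (sq_nonneg _)) hWs.le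
  have hn2 : 0 ≤ (∑ a ∈ t, w a * g a ^ 2) / ∑ a ∈ t, w a :=
    div_nonneg (sum_nonneg fun a _ => mul_nonneg (hw a).le (sq_nonneg _)) hWt.le
  rw [e, sub_sq, Real.sq_sqrt hn1, Real.sq_sqrt hn2]
  have h3 : ((∑ a ∈ s, w a * g a) / ∑ a ∈ s, w a) * ((∑ a ∈ t, w a * g a) / ∑ a ∈ t, w a)
      ≤ √((∑ a ∈ s, w a * g a ^ 2) / ∑ a ∈ s, w a) *
        √((∑ a ∈ t, w a * g a ^ 2) / ∑ a ∈ t, w a) := by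
    refine (le_abs_self _).trans ?_
    rw [abs_mul]
    exact mul_le_mul h1 h2 (abs_nonneg _) (Real.sqrt_nonneg _)
  have e2 : ((∑ a ∈ s, w a * g a ^ 2) * (∑ a ∈ t, w a)
        + (∑ a ∈ s, w a) * (∑ a ∈ t, w a * g a ^ 2)
        - 2 * ((∑ a ∈ s, w a * g a) * (∑ a ∈ t, w a * g a))) / ((∑ a ∈ s, w a) * ∑ a ∈ t, w a)
      = (∑ a ∈ s, w a * g a ^ 2) / (∑ a ∈ s, w a) + (∑ a ∈ t, w a * g a ^ 2) / (∑ a ∈ t, w a)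
        - 2 * (((∑ a ∈ s, w a * g a) / ∑ a ∈ s, w a)
          * ((∑ a ∈ t, w a * g a) / ∑ a ∈ t, w a)) := by
    field_simp
  rw [e2]
  linarith

/-- The Dirichlet form with kernel `k`. -/
def energy [Fintype α] (k : α → α → ℝ) (g : α → ℝ) : ℝ := ∑ a, ∑ b, k a b * (g a - g b) ^ 2

/-- Kernel joining two disjoint finite sets by the product coupling. -/
noncomputable def joinKernel [DecidableEq α] (s t : Finset α) (w : α → ℝ) (a b : α) : ℝ :=
  if a ∈ s ∧ b ∈ t then
    (∑ c ∈ s, w c + ∑ c ∈ t, w c) * (w a * w b / ((∑ c ∈ s, w c) * ∑ c ∈ t, w c)) else 0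

lemma energy_add [Fintype α] (k l : α → α → ℝ) (g : α → ℝ) :
    energy (fun a b => k a b + l a b) g = energy k g + energy l g := by
  simp only [energy, add_mul, sum_add_distrib]

lemma joinKernel_nonneg [DecidableEq α] (s t : Finset α) (w : α → ℝ) (hw : ∀ a, 0 < w a) (a b : α) :
    0 ≤ joinKernel s t w a b := by
  have h : ∀ r : Finset α, 0 ≤ ∑ c ∈ r, w c := fun r => sum_nonneg fun c _ => (hw c).le
  unfold joinKernel
  split_ifs
  · exact mul_nonneg (add_nonneg (h s) (h t))
      (div_nonneg (mul_nonneg (hw a).le (hw b).le) (mul_nonneg (h s) (h t)))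
  · rfl

variable [Fintype α] [DecidableEq α]

lemma energy_joinKernel (s t : Finset α) (w g : α → ℝ) :
    energy (joinKernel s t w) g = (∑ c ∈ s, w c + ∑ c ∈ t, w c) *
      ((∑ a ∈ s, ∑ b ∈ t, w a * w b * (g a - g b) ^ 2)
        / ((∑ a ∈ s, w a) * ∑ a ∈ t, w a)) := by
  have e : energy (joinKernel s t w) g
      = ∑ a ∈ s, ∑ b ∈ t, joinKernel s t w a b * (g a - g b) ^ 2 := by
    unfold energy
    symm
    refine (sum_subset (subset_univ s) fun a _ ha => ?_).trans (sum_congr rfl fun a _ => ?_)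
    · exact sum_eq_zero fun b _ => by simp [joinKernel, ha]
    · exact sum_subset (subset_univ t) fun b _ hb => by simp [joinKernel, hb]
  rw [e, sum_div, mul_sum]
  refine sum_congr rfl fun a ha => ?_
  rw [sum_div, mul_sum]
  refine sum_congr rfl fun b hb => ?_
  simp only [joinKernel, ha, hb, and_self, if_true]
  ring

lemma energy_joinKernel_eq_zero (s t : Finset α) (w g : α → ℝ)
    (hg : ∀ a ∈ s, ∀ b ∈ t, g a = g b) : energy (joinKernel s t w) g = 0 := by
  have h : ∑ a ∈ s, ∑ b ∈ t, w a * w b * (g a - g b) ^ 2 = 0 :=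
    sum_eq_zero fun a ha => sum_eq_zero fun b hb => by rw [hg a ha b hb]; ring
  rw [energy_joinKernel, h, zero_div, mul_zero]

lemma energy_joinKernel_le (s t : Finset α) (w g : α → ℝ) (hw : ∀ a, 0 < w a)
    (hg : ∀ a, g a = 0 ∨ g a = 1) :
    energy (joinKernel s t w) g ≤ ∑ c ∈ s, w c + ∑ c ∈ t, w c := by
  have h : ∀ r : Finset α, 0 ≤ ∑ c ∈ r, w c := fun r => sum_nonneg fun c _ => (hw c).le
  rw [energy_joinKernel]
  refine mul_le_of_le_one_right (add_nonneg (h s) (h t)) (div_le_one_of_le₀ ?_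
    (mul_nonneg (h s) (h t)))
  rw [sum_mul_sum]
  refine sum_le_sum fun a _ => sum_le_sum fun b _ => ?_
  refine mul_le_of_le_one_right (mul_nonneg (hw a).le (hw b).le) ?_
  rcases hg a with h1 | h1 <;> rcases hg b with h2 | h2 <;> rw [h1, h2] <;> norm_num

lemma entOn_union_le (s t : Finset α) (w g : α → ℝ) (hw : ∀ a, 0 < w a) (hst : Disjoint s t) :
    entOn (s ∪ t) w (fun a => g a ^ 2) ≤ entOn s w (fun a => g a ^ 2)
      + entOn t w (fun a => g a ^ 2) + energy (joinKernel s t w) g := by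
  rcases s.eq_empty_or_nonempty with rfl | hs
  · rw [energy_joinKernel]; simp [entOn]
  rcases t.eq_empty_or_nonempty with rfl | ht
  · rw [energy_joinKernel]; simp [entOn]
  have hWs : 0 < ∑ a ∈ s, w a := sum_pos (fun a _ => hw a) hs
  have hWt : 0 < ∑ a ∈ t, w a := sum_pos (fun a _ => hw a) ht
  have hS : ∀ r : Finset α, 0 ≤ ∑ a ∈ r, w a * g a ^ 2 :=
    fun r => sum_nonneg fun a _ => mul_nonneg (hw a).le (sq_nonneg _)
  have h1 := two_point_entropy_le hWs hWt (hS s) (hS t)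
  have h2 := mul_le_mul_of_nonneg_left (sqrt_sub_sqrt_sq_le s t w g hw hs ht)
    (add_pos hWs hWt).le
  rw [energy_joinKernel]
  simp only [entOn, sum_union hst]
  linarith

/-- A median of a finite set of positive weights. -/
lemma exists_median {α : Type*} [LinearOrder α] (s : Finset α) (hs : s.Nonempty) (w : α → ℝ)
    (hw : ∀ a, 0 < w a) :
    ∃ m ∈ s, ∑ a ∈ s with a < m, w a ≤ (∑ a ∈ s, w a) / 2 ∧
      ∑ a ∈ s with m < a, w a ≤ (∑ a ∈ s, w a) / 2 := by
  have hW : 0 < ∑ a ∈ s, w a := sum_pos (fun a _ => hw a) hs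
  let P := s.filter fun m => (∑ a ∈ s, w a) / 2 ≤ ∑ a ∈ s with a ≤ m, w a
  have hP : P.Nonempty := by
    refine ⟨s.max' hs, mem_filter.2 ⟨s.max'_mem hs, ?_⟩⟩
    rw [filter_true_of_mem fun a ha => s.le_max' a ha]
    linarith
  obtain ⟨hm, hm2⟩ := mem_filter.1 (P.min'_mem hP)
  refine ⟨P.min' hP, hm, ?_, ?_⟩
  · rcases (s.filter (· < P.min' hP)).eq_empty_or_nonempty with he | hne
    · rw [he, sum_empty]; linarith
    · obtain ⟨h1, h2⟩ := mem_filter.1 ((s.filter (· < P.min' hP)).max'_mem hne)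
      by_contra! hcon
      refine absurd (P.min'_le ((s.filter (· < P.min' hP)).max' hne) (mem_filter.2 ⟨h1, ?_⟩))
        (not_le.2 h2)
      refine hcon.le.trans (sum_le_sum_of_subset_of_nonneg ?_ fun a _ _ => (hw a).le)
      intro a ha
      exact mem_filter.2 ⟨(mem_filter.1 ha).1, le_max' _ _ ha⟩
  · have := sum_filter_add_sum_filter_not s (fun a => a ≤ P.min' hP) w
    simp only [not_le] at this
    linarith

/-- Logarithmic Sobolev inequality on a finite chain, for a Dirichlet form which is bounded on
monotone indicator functions. -/
lemma exists_kernel_on {α : Type*} [Fintype α] [LinearOrder α] (w : α → ℝ) (hw : ∀ a, 0 < w a)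
    (s : Finset α) :
    ∃ k : α → α → ℝ, (∀ a b, 0 ≤ k a b) ∧
      (∀ g : α → ℝ, entOn s w (fun a => g a ^ 2) ≤ energy k g) ∧
      (∀ g : α → ℝ, (∀ a, g a = 0 ∨ g a = 1) → Antitone g → energy k g ≤ 4 * ∑ a ∈ s, w a) ∧
      ∀ g : α → ℝ, (∀ a ∈ s, ∀ b ∈ s, g a = g b) → energy k g = 0 := by
  induction s using Finset.strongInduction with
  | H s ih =>
    rcases s.eq_empty_or_nonempty with rfl | hs
    · exact ⟨fun _ _ => 0, by simp, by simp [entOn, energy], by simp [energy], by simp [energy]⟩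
    obtain ⟨m, hm, hL, hR⟩ := exists_median s hs w hw
    obtain ⟨k₁, hk₁, hE₁, hM₁, hC₁⟩ := ih (s.filter (· < m))
      (filter_ssubset.2 ⟨m, hm, lt_irrefl m⟩)
    obtain ⟨k₂, hk₂, hE₂, hM₂, hC₂⟩ := ih (s.filter (m < ·))
      (filter_ssubset.2 ⟨m, hm, lt_irrefl m⟩)
    set L := s.filter (· < m) with hLdef
    set R := s.filter (m < ·) with hRdef
    have hd1 : Disjoint L {m} := by simp [hLdef]
    have hd2 : Disjoint (L ∪ {m}) R := by
      rw [disjoint_left]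
      intro a ha hb
      simp only [hLdef, hRdef, mem_union, mem_filter, mem_singleton] at ha hb
      rcases ha with ha | rfl
      · exact absurd ha.2 (not_lt.2 hb.2.le)
      · exact lt_irrefl _ hb.2
    have hu : s = L ∪ {m} ∪ R := by
      ext a
      simp only [hLdef, hRdef, mem_union, mem_filter, mem_singleton]
      rcases lt_trichotomy a m with h | rfl | h
      · simp [h, h.ne, h.le.not_gt]
      · simp [hm]
      · simp [h, h.ne', h.le.not_gt]
    have hsum1 : ∑ a ∈ L ∪ {m}, w a + ∑ a ∈ R, w a = ∑ a ∈ s, w a := by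
      rw [← sum_union hd2, ← hu]
    have hsum2 : ∑ a ∈ L, w a + ∑ a ∈ {m}, w a = ∑ a ∈ L ∪ {m}, w a := by rw [sum_union hd1]
    have hRpos : 0 ≤ ∑ a ∈ R, w a := sum_nonneg fun a _ => (hw a).le
    refine ⟨fun a b => (k₁ a b + k₂ a b) +
      (joinKernel L {m} w a b + joinKernel (L ∪ {m}) R w a b), ?_, ?_, ?_, ?_⟩
    · intro a b
      exact add_nonneg (add_nonneg (hk₁ a b) (hk₂ a b))
        (add_nonneg (joinKernel_nonneg _ _ _ hw _ _) (joinKernel_nonneg _ _ _ hw _ _))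
    · intro g
      rw [energy_add, energy_add, energy_add]
      have h1 := entOn_union_le L {m} w g hw hd1
      have h2 := entOn_union_le (L ∪ {m}) R w g hw hd2
      rw [← hu] at h2
      have h3 : entOn {m} w (fun a => g a ^ 2) = 0 := by
        simp only [entOn, sum_singleton]
        by_cases hg : g m = 0
        · simp [hg]
        · rw [Real.log_mul (hw m).ne' (pow_ne_zero 2 hg)]
          ring
      linarith [hE₁ g, hE₂ g]
    · intro g hg hanti
      rw [energy_add, energy_add, energy_add]
      have h1 := energy_joinKernel_le L {m} w g hw hg
      have h2 := energy_joinKernel_le (L ∪ {m}) R w g hw hg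
      have h3 : energy k₁ g + energy k₂ g ≤ 4 * ((∑ a ∈ s, w a) / 2) := by
        rcases hg m with h | h
        · have hz : ∀ a ∈ R, g a = 0 := fun a ha => by
            have h4 := hanti (mem_filter.1 ha).2.le
            rcases hg a with h5 | h5
            · exact h5
            · linarith
          rw [hC₂ g fun a ha b hb => by rw [hz a ha, hz b hb]]
          linarith [hM₁ g hg hanti]
        · have hz : ∀ a ∈ L, g a = 1 := fun a ha => by
            have h4 := hanti (mem_filter.1 ha).2.le
            rcases hg a with h5 | h5
            · linarith
            · exact h5
          rw [hC₁ g fun a ha b hb => by rw [hz a ha, hz b hb]]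
          linarith [hM₂ g hg hanti]
      linarith
    · intro g hg
      have hLs : L ⊆ s := filter_subset _ _
      have hRs : R ⊆ s := filter_subset _ _
      have hms : {m} ⊆ s := singleton_subset_iff.2 hm
      rw [energy_add, energy_add, energy_add,
        hC₁ g fun a ha b hb => hg a (hLs ha) b (hLs hb),
        hC₂ g fun a ha b hb => hg a (hRs ha) b (hRs hb),
        energy_joinKernel_eq_zero _ _ _ _ fun a ha b hb => hg a (hLs ha) b (hms hb),
        energy_joinKernel_eq_zero _ _ _ _ fun a ha b hb =>
          hg a (union_subset hLs hms ha) b (hRs hb)]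
      norm_num

end Entropy

section ProductSpace

open Finset

variable {α : Type*} [Fintype α] {n : ℕ}

/-- Expectation with respect to the `n`-fold product of the weights `w`. -/
def pexp (w : α → ℝ) (F : (Fin n → α) → ℝ) : ℝ := ∑ x, (∏ i, w (x i)) * F x

lemma pexp_zero (w : α → ℝ) (F : (Fin 0 → α) → ℝ) : pexp w F = F ![] := by
  simp [pexp, Subsingleton.elim default (![] : Fin 0 → α)]

lemma pexp_succ (w : α → ℝ) (F : (Fin (n + 1) → α) → ℝ) :
    pexp w F = ∑ a, w a * pexp w (fun y => F (Fin.cons a y)) := by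
  unfold pexp
  rw [← (Fin.consEquiv fun _ => α).sum_comp, Fintype.sum_prod_type]
  refine sum_congr rfl fun a _ => ?_
  rw [mul_sum]
  refine sum_congr rfl fun y _ => ?_
  simp [Fin.consEquiv, Fin.prod_univ_succ, mul_assoc]

lemma pexp_add (w : α → ℝ) (F G : (Fin n → α) → ℝ) :
    pexp w (fun x => F x + G x) = pexp w F + pexp w G := by
  simp only [pexp, mul_add, sum_add_distrib]

lemma pexp_sub (w : α → ℝ) (F G : (Fin n → α) → ℝ) :
    pexp w (fun x => F x - G x) = pexp w F - pexp w G := by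
  simp only [pexp, mul_sub, sum_sub_distrib]

lemma pexp_mul_left (w : α → ℝ) (c : ℝ) (F : (Fin n → α) → ℝ) :
    pexp w (fun x => c * F x) = c * pexp w F := by
  simp only [pexp, mul_sum]
  exact sum_congr rfl fun x _ => by ring

lemma pexp_sum {ι : Type*} (s : Finset ι) (w : α → ℝ) (F : ι → (Fin n → α) → ℝ) :
    pexp w (fun x => ∑ i ∈ s, F i x) = ∑ i ∈ s, pexp w (F i) := by
  simp only [pexp, mul_sum]
  exact sum_comm

lemma pexp_mono {w : α → ℝ} (hw : ∀ a, 0 ≤ w a) {F G : (Fin n → α) → ℝ} (h : ∀ x, F x ≤ G x) :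
    pexp w F ≤ pexp w G :=
  sum_le_sum fun x _ => mul_le_mul_of_nonneg_left (h x) (prod_nonneg fun i _ => hw (x i))

lemma pexp_nonneg {w : α → ℝ} (hw : ∀ a, 0 ≤ w a) {F : (Fin n → α) → ℝ} (h : ∀ x, 0 ≤ F x) :
    0 ≤ pexp w F :=
  sum_nonneg fun x _ => mul_nonneg (prod_nonneg fun i _ => hw (x i)) (h x)

lemma pexp_const {w : α → ℝ} (hw : ∑ a, w a = 1) (c : ℝ) :
    pexp w (fun _ : Fin n → α => c) = c := by
  induction n with
  | zero => rw [pexp_zero]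
  | succ n ih => rw [pexp_succ, ← sum_mul, hw, one_mul, ih]

lemma abs_pexp_le {w : α → ℝ} (hw : ∀ a, 0 ≤ w a) (F : (Fin n → α) → ℝ) :
    |pexp w F| ≤ pexp w (fun x => |F x|) := by
  refine (abs_sum_le_sum_abs _ _).trans (le_of_eq (sum_congr rfl fun x _ => ?_))
  rw [abs_mul, abs_of_nonneg (prod_nonneg fun i _ => hw (x i))]

lemma pexp_mul_le {w : α → ℝ} (hw : ∀ a, 0 ≤ w a) (F G : (Fin n → α) → ℝ) :
    pexp w (fun x => F x * G x) ≤
      √(pexp w (fun x => F x ^ 2)) * √(pexp w (fun x => G x ^ 2)) := by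
  have hp : ∀ x : Fin n → α, 0 ≤ ∏ i, w (x i) := fun x => prod_nonneg fun i _ => hw (x i)
  rw [← Real.sqrt_mul (pexp_nonneg hw fun x => sq_nonneg _)]
  apply Real.le_sqrt_of_sq_le
  exact sum_sq_le_sum_mul_sum_of_sq_le_mul univ
    (fun x _ => mul_nonneg (hp x) (sq_nonneg _)) (fun x _ => mul_nonneg (hp x) (sq_nonneg _))
    (fun x _ => le_of_eq (by ring))

lemma sqrt_pexp_sub_sq_le {w : α → ℝ} (hw : ∀ a, 0 ≤ w a) (F G : (Fin n → α) → ℝ) :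
    (√(pexp w (fun x => F x ^ 2)) - √(pexp w (fun x => G x ^ 2))) ^ 2
      ≤ pexp w (fun x => (F x - G x) ^ 2) := by
  have h := pexp_mul_le hw F G
  have e : pexp w (fun x => (F x - G x) ^ 2)
      = pexp w (fun x => F x ^ 2) - 2 * pexp w (fun x => F x * G x)
        + pexp w (fun x => G x ^ 2) := by
    rw [← pexp_mul_left, ← pexp_sub, ← pexp_add]
    congr 1
    funext x
    ring
  rw [sub_sq, Real.sq_sqrt (pexp_nonneg hw fun x => sq_nonneg _),
    Real.sq_sqrt (pexp_nonneg hw fun x => sq_nonneg _), e]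
  linarith

/-- Entropy with respect to the `n`-fold product of the weights `w`. -/
noncomputable def pent (w : α → ℝ) (F : (Fin n → α) → ℝ) : ℝ :=
  pexp w (fun x => F x * Real.log (F x)) - pexp w F * Real.log (pexp w F)

lemma entOn_univ {w : α → ℝ} (hw : ∑ a, w a = 1) (h : α → ℝ) :
    entOn univ w h = ∑ a, w a * (h a * Real.log (h a))
      - (∑ a, w a * h a) * Real.log (∑ a, w a * h a) := by
  simp [entOn, hw]

lemma pent_succ {w : α → ℝ} (hw : ∑ a, w a = 1) (F : (Fin (n + 1) → α) → ℝ) :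
    pent w F = ∑ a, w a * pent w (fun y => F (Fin.cons a y))
      + entOn univ w (fun a => pexp w (fun y => F (Fin.cons a y))) := by
  rw [entOn_univ hw]
  unfold pent
  rw [pexp_succ, pexp_succ w F]
  simp only [mul_sub, sum_sub_distrib]
  ring

/-- The `L²` norm is controlled from below by entropy and the `L¹` norm. -/
lemma le_pent_sq {w : α → ℝ} (hw : ∀ a, 0 ≤ w a) (F : (Fin n → α) → ℝ) {θ : ℝ} (hθ : 0 < θ) :
    pexp w (fun x => F x ^ 2) * Real.log θ + pexp w (fun x => F x ^ 2)
      - θ * pexp w (fun x => |F x|) ^ 2 ≤ pent w (fun x => F x ^ 2) := by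
  have key : ∀ c : ℝ, 0 < c → 2 * (pexp w (fun x => F x ^ 2) * (1 + Real.log c)
      - c * pexp w (fun x => |F x|)) ≤ pexp w (fun x => F x ^ 2 * Real.log (F x ^ 2)) := by
    intro c hc
    have e : 2 * (pexp w (fun x => F x ^ 2) * (1 + Real.log c) - c * pexp w (fun x => |F x|))
        = pexp w (fun x => 2 * ((1 + Real.log c) * F x ^ 2 - c * |F x|)) := by
      rw [pexp_mul_left, pexp_sub, pexp_mul_left, pexp_mul_left]
      ring
    rw [e]
    refine pexp_mono hw fun x => ?_
    rcases eq_or_ne (F x) 0 with h | h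
    · simp [h]
    have hpos : 0 < |F x| := abs_pos.2 h
    have h1 := Real.log_le_sub_one_of_pos (div_pos hc hpos)
    rw [Real.log_div hc.ne' hpos.ne'] at h1
    have h2 := mul_le_mul_of_nonneg_left h1 (sq_nonneg (|F x|))
    have h3 : |F x| ^ 2 * (c / |F x| - 1) = c * |F x| - |F x| ^ 2 := by
      field_simp
    rw [← sq_abs (F x), Real.log_pow]
    push_cast
    nlinarith
  set A := pexp w (fun x => F x ^ 2) with hA
  set B := pexp w (fun x => |F x|) with hB
  have hA0 : 0 ≤ A := pexp_nonneg hw fun x => sq_nonneg _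
  have hB0 : 0 ≤ B := pexp_nonneg hw fun x => abs_nonneg _
  unfold pent
  rw [← hA]
  rcases hA0.eq_or_lt with h0 | hApos
  · have h1 : 0 ≤ pexp w (fun x => F x ^ 2 * Real.log (F x ^ 2)) := by
      refine le_of_eq ?_
      symm
      have hz := (sum_eq_zero_iff_of_nonneg fun x _ =>
        mul_nonneg (prod_nonneg fun i _ => hw (x i)) (sq_nonneg (F x))).1 h0.symm
      refine sum_eq_zero fun x hx => ?_
      rw [← mul_assoc, hz x hx, zero_mul]
    rw [← h0]
    have : 0 ≤ θ * B ^ 2 := by positivity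
    simp only [zero_mul]
    linarith
  have hθA : 0 < θ * A := mul_pos hθ hApos
  have h1 := key (√(θ * A)) (Real.sqrt_pos.2 hθA)
  have h2 : Real.log (√(θ * A)) = (Real.log θ + Real.log A) / 2 := by
    rw [Real.log_sqrt hθA.le, Real.log_mul hθ.ne' hApos.ne']
  rw [h2] at h1
  have h3 : 2 * (√(θ * A) * B) ≤ θ * B ^ 2 + A := by
    rw [Real.sqrt_mul hθ.le]
    have h4 := sq_nonneg (√θ * B - √A)
    rw [sub_sq, mul_pow, Real.sq_sqrt hθ.le, Real.sq_sqrt hA0] at h4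
    linarith
  linarith

/-- The martingale differences obtained by revealing the coordinates one after the other. -/
def mdiff (w : α → ℝ) : (n : ℕ) → Fin n → ((Fin n → α) → ℝ) → (Fin n → α) → ℝ
  | 0, _, _, _ => 0
  | n + 1, j, f, x => Fin.cases (motive := fun _ => ℝ)
      (pexp w (fun y => f (Fin.cons (x 0) y)) - pexp w f)
      (fun i => mdiff w n i (fun y => f (Fin.cons (x 0) y)) (Fin.tail x)) j

lemma mdiff_zero (w : α → ℝ) (f : (Fin (n + 1) → α) → ℝ) (a : α) (y : Fin n → α) :
    mdiff w (n + 1) 0 f (Fin.cons a y) = pexp w (fun y => f (Fin.cons a y)) - pexp w f := rfl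

lemma mdiff_succ (w : α → ℝ) (f : (Fin (n + 1) → α) → ℝ) (j : Fin n) (a : α) (y : Fin n → α) :
    mdiff w (n + 1) j.succ f (Fin.cons a y) = mdiff w n j (fun y => f (Fin.cons a y)) y := rfl

lemma mdiff_sub (w : α → ℝ) (j : Fin n) (f g : (Fin n → α) → ℝ) (x : Fin n → α) :
    mdiff w n j (fun x => f x - g x) x = mdiff w n j f x - mdiff w n j g x := by
  induction n with
  | zero => exact j.elim0
  | succ n ih =>
    refine Fin.consCases (fun a y => ?_) x
    refine Fin.cases ?_ (fun j => ?_) j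
    · simp only [mdiff_zero, pexp_sub]
      ring
    · simp only [mdiff_succ, ih]

lemma sum_pexp_mdiff_sq {w : α → ℝ} (hw : ∑ a, w a = 1) (f : (Fin n → α) → ℝ) :
    ∑ j, pexp w (fun x => mdiff w n j f x ^ 2) = pexp w (fun x => f x ^ 2) - pexp w f ^ 2 := by
  induction n with
  | zero => simp [pexp_zero]
  | succ n ih =>
    rw [Fin.sum_univ_succ, pexp_succ, pexp_succ w (fun x => f x ^ 2)]
    simp only [pexp_succ w (fun x => mdiff w (n + 1) _ f x ^ 2), mdiff_zero, mdiff_succ]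
    rw [sum_comm]
    simp only [← mul_sum, ih, pexp_const hw]
    rw [pexp_succ w f]
    set E := fun a => pexp w (fun y => f (Fin.cons a y)) with hE
    have h1 : ∑ a, w a * (E a - ∑ b, w b * E b) ^ 2
        = ∑ a, w a * E a ^ 2 - (∑ b, w b * E b) ^ 2 := by
      have : ∀ m : ℝ, ∑ a, w a * (E a - m) ^ 2
          = ∑ a, w a * E a ^ 2 - 2 * m * ∑ a, w a * E a + m ^ 2 * ∑ a, w a := by
        intro m
        rw [mul_sum, mul_sum, ← sum_sub_distrib, ← sum_add_distrib]
        exact sum_congr rfl fun a _ => by ring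
      rw [this, hw]
      ring
    rw [h1]
    simp only [mul_sub, sum_sub_distrib]
    ring

/-- The entropies of the squared martingale differences are controlled by the Dirichlet form. -/
lemma sum_pent_mdiff_le {w : α → ℝ} (hw0 : ∀ a, 0 ≤ w a) (hw : ∑ a, w a = 1) {k : α → α → ℝ}
    (hk : ∀ a b, 0 ≤ k a b) (hlsi : ∀ g : α → ℝ, entOn univ w (fun a => g a ^ 2) ≤ energy k g)
    (f : (Fin n → α) → ℝ) :
    ∑ j, pent w (fun x => mdiff w n j f x ^ 2)
      ≤ ∑ i, pexp w (fun x => energy k (fun u => f (Function.update x i u))) := by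
  induction n with
  | zero => simp
  | succ n ih =>
    set G : α → (Fin n → α) → ℝ := fun a y => f (Fin.cons a y) with hG
    have e1 : ∑ j, pent w (fun x => mdiff w (n + 1) j f x ^ 2)
        = entOn univ w (fun a => (pexp w (G a) - pexp w f) ^ 2)
          + ∑ a, w a * ∑ j, pent w (fun y => mdiff w n j (G a) y ^ 2)
          + ∑ j, entOn univ w (fun a => pexp w (fun y => mdiff w n j (G a) y ^ 2)) := by
      rw [Fin.sum_univ_succ, pent_succ hw]
      simp only [pent_succ hw (fun x => mdiff w (n + 1) (Fin.succ _) f x ^ 2), mdiff_zero,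
        mdiff_succ, pexp_const hw, sum_add_distrib]
      have h0 : ∀ c : ℝ, pent w (fun _ : Fin n → α => c) = 0 := by
        intro c
        simp only [pent, pexp_const hw, sub_self]
      simp only [h0, mul_zero, sum_const_zero, zero_add]
      rw [sum_comm]
      simp only [← mul_sum]
      rw [add_assoc]
    have e2 : ∑ i, pexp w (fun x => energy k (fun u => f (Function.update x i u)))
        = pexp w (fun y => energy k (fun u => G u y))
          + ∑ a, w a * ∑ i, pexp w (fun y => energy k (fun u => G a (Function.update y i u))) := by
      rw [Fin.sum_univ_succ, pexp_succ]
      simp only [pexp_succ w (fun x => energy k (fun u => f (Function.update x (Fin.succ _) u))),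
        Fin.update_cons_zero, ← Fin.cons_update]
      rw [← sum_mul, hw, one_mul, sum_comm]
      simp only [← mul_sum]
      rfl
    have h1 : ∑ a, w a * ∑ j, pent w (fun y => mdiff w n j (G a) y ^ 2)
        ≤ ∑ a, w a * ∑ i, pexp w (fun y => energy k (fun u => G a (Function.update y i u))) :=
      sum_le_sum fun a _ => mul_le_mul_of_nonneg_left (ih (G a)) (hw0 a)
    have h2 := hlsi (fun a => pexp w (G a) - pexp w f)
    have h3 : ∀ j, entOn univ w (fun a => pexp w (fun y => mdiff w n j (G a) y ^ 2))
        ≤ ∑ a, ∑ b, k a b * pexp w (fun y => mdiff w n j (fun z => G a z - G b z) y ^ 2) := by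
      intro j
      have h4 := hlsi (fun a => √(pexp w (fun y => mdiff w n j (G a) y ^ 2)))
      have h5 : ∀ a, √(pexp w (fun y => mdiff w n j (G a) y ^ 2)) ^ 2
          = pexp w (fun y => mdiff w n j (G a) y ^ 2) :=
        fun a => Real.sq_sqrt (pexp_nonneg hw0 fun x => sq_nonneg _)
      simp only [h5] at h4
      refine h4.trans (sum_le_sum fun a _ => sum_le_sum fun b _ =>
        mul_le_mul_of_nonneg_left ?_ (hk a b))
      simp only [mdiff_sub]
      exact sqrt_pexp_sub_sq_le hw0 _ _
    have h6 : ∑ j, ∑ a, ∑ b, k a b * pexp w (fun y => mdiff w n j (fun z => G a z - G b z) y ^ 2)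
        = ∑ a, ∑ b, k a b * (pexp w (fun y => (G a y - G b y) ^ 2)
          - (pexp w (G a) - pexp w (G b)) ^ 2) := by
      rw [sum_comm]
      refine sum_congr rfl fun a _ => ?_
      rw [sum_comm]
      refine sum_congr rfl fun b _ => ?_
      rw [← mul_sum, sum_pexp_mdiff_sq hw, pexp_sub]
    have h7 : pexp w (fun y => energy k (fun u => G u y))
        = ∑ a, ∑ b, k a b * pexp w (fun y => (G a y - G b y) ^ 2) := by
      unfold energy
      simp only [pexp_sum, pexp_mul_left]
    have h8 := sum_le_sum fun j (_ : j ∈ univ) => h3 j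
    rw [h6] at h8
    simp only [mul_sub, sum_sub_distrib] at h8
    simp only [energy, sub_sub_sub_cancel_right] at h2
    rw [e1, e2, h7]
    linarith

/-- Mean absolute deviation. -/
def absDev (w g : α → ℝ) : ℝ := ∑ a, w a * |g a - ∑ b, w b * g b|

lemma pexp_abs_mdiff_le {w : α → ℝ} (hw0 : ∀ a, 0 ≤ w a) (hw : ∑ a, w a = 1)
    (f : (Fin n → α) → ℝ) (j : Fin n) :
    pexp w (fun x => |mdiff w n j f x|)
      ≤ pexp w (fun x => absDev w (fun u => f (Function.update x j u))) := by
  induction n with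
  | zero => exact j.elim0
  | succ n ih =>
    rw [pexp_succ, pexp_succ w (fun x => absDev w _)]
    refine Fin.cases ?_ (fun j => ?_) j
    · simp only [mdiff_zero, Fin.update_cons_zero, pexp_const hw]
      rw [← sum_mul, hw, one_mul]
      unfold absDev
      rw [pexp_sum]
      simp only [pexp_mul_left]
      refine sum_le_sum fun a _ => mul_le_mul_of_nonneg_left ?_ (hw0 a)
      refine le_trans (le_of_eq ?_) (abs_pexp_le hw0 _)
      rw [pexp_sub, pexp_sum, pexp_succ w f]
      simp only [pexp_mul_left]
    · simp only [mdiff_succ, ← Fin.cons_update]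
      exact sum_le_sum fun a _ => mul_le_mul_of_nonneg_left (ih _ j) (hw0 a)

/-- Talagrand-type inequality on a product space whose factors satisfy a logarithmic Sobolev
inequality. -/
theorem variance_mul_log_le {w : α → ℝ} (hw0 : ∀ a, 0 ≤ w a) (hw : ∑ a, w a = 1)
    {k : α → α → ℝ} (hk : ∀ a b, 0 ≤ k a b)
    (hlsi : ∀ g : α → ℝ, entOn univ w (fun a => g a ^ 2) ≤ energy k g)
    (f : (Fin n → α) → ℝ) {θ : ℝ} (hθ : 0 < θ) :
    (pexp w (fun x => f x ^ 2) - pexp w f ^ 2) * (Real.log θ + 1)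
      ≤ ∑ i, pexp w (fun x => energy k (fun u => f (Function.update x i u)))
        + θ * ∑ i, pexp w (fun x => absDev w (fun u => f (Function.update x i u))) ^ 2 := by
  have h1 := sum_pent_mdiff_le hw0 hw hk hlsi f
  have h2 : ∀ j, pexp w (fun x => mdiff w n j f x ^ 2) * (Real.log θ + 1)
      - θ * pexp w (fun x => absDev w (fun u => f (Function.update x j u))) ^ 2
      ≤ pent w (fun x => mdiff w n j f x ^ 2) := by
    intro j
    have h3 := le_pent_sq hw0 (mdiff w n j f) hθ
    have h4 := pow_le_pow_left₀ (pexp_nonneg hw0 fun x => abs_nonneg _)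
      (pexp_abs_mdiff_le hw0 hw f j) 2
    have h5 := mul_le_mul_of_nonneg_left h4 hθ.le
    linarith
  have h6 := sum_le_sum fun j (_ : j ∈ univ) => h2 j
  rw [sum_sub_distrib, ← sum_mul, ← mul_sum, sum_pexp_mdiff_sq hw] at h6
  linarith

end ProductSpace

section SequentialSampling

open Finset

/-- Positive weights on a finite set of positive reals whose partial sums are the points. -/
lemma exists_weights (S : Finset ℝ) (hS : ∀ p ∈ S, 0 < p) :
    ∃ w : ℝ → ℝ, (∀ a, 0 < w a) ∧ ∀ p ∈ S, ∑ a ∈ S with a ≤ p, w a = p := by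
  induction S using Finset.induction_on_max with
  | empty => exact ⟨fun _ => 1, by simp, by simp⟩
  | insert m S hm ih =>
    obtain ⟨w, hw, hsum⟩ := ih fun p hp => hS p (mem_insert_of_mem hp)
    have hmS : m ∉ S := fun h => lt_irrefl _ (hm m h)
    have htot : ∑ a ∈ S, w a < m := by
      rcases S.eq_empty_or_nonempty with rfl | hne
      · simpa using hS m (mem_insert_self _ _)
      · have h := hsum _ (S.max'_mem hne)
        rw [filter_true_of_mem fun a ha => S.le_max' a ha] at h
        rw [h]
        exact hm _ (S.max'_mem hne)
    have hcong : ∀ s ⊆ S, ∑ a ∈ s, Function.update w m (m - ∑ a ∈ S, w a) a = ∑ a ∈ s, w a :=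
      fun s hs => sum_congr rfl fun a ha => Function.update_of_ne
        (fun h => hmS (by rw [← h]; exact hs ha)) _ _
    refine ⟨Function.update w m (m - ∑ a ∈ S, w a), fun a => ?_, fun p hp => ?_⟩
    · rcases eq_or_ne a m with rfl | h
      · rw [Function.update_self]; linarith
      · rw [Function.update_of_ne h]; exact hw a
    · rcases mem_insert.1 hp with rfl | hp
      · rw [filter_true_of_mem, sum_insert hmS, hcong S subset_rfl, Function.update_self]
        · ring
        · intro a ha
          rcases mem_insert.1 ha with rfl | ha
          · rfl
          · exact (hm a ha).le
      · rw [filter_insert, if_neg (not_le.2 (hm p hp)), hcong _ (filter_subset _ _), hsum p hp]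

variable {n : ℕ}

/-- The configuration obtained by applying the rules `T j` one coordinate after the other. -/
def seqSol (T : Fin n → (Fin n → Bool) → Bool) (j : Fin n) : Bool :=
  T j fun i => if _h : i < j then seqSol T i else false
termination_by j

lemma seqSol_eq_iff {T : Fin n → (Fin n → Bool) → Bool}
    (hT : ∀ j ω ω', (∀ i < j, ω i = ω' i) → T j ω = T j ω') (ω : Fin n → Bool) :
    seqSol T = ω ↔ ∀ j, T j ω = ω j := by
  constructor
  · rintro rfl j
    conv_rhs => rw [seqSol]
    exact hT _ _ _ fun i hi => by simp [hi]
  · intro h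
    funext j
    induction j using WellFoundedLT.induction with
    | ind j ih =>
      rw [seqSol, ← h j]
      exact hT _ _ _ fun i hi => by simp [hi, ih i hi]

lemma seqSol_mono {T T' : Fin n → (Fin n → Bool) → Bool} (hT' : ∀ j, Monotone (T' j))
    (hle : ∀ j ω, T j ω ≤ T' j ω) : seqSol T ≤ seqSol T' := by
  intro j
  induction j using WellFoundedLT.induction with
  | ind j ih =>
    rw [seqSol, seqSol]
    refine (hle _ _).trans (hT' j fun i => ?_)
    by_cases hi : i < j
    · simpa [hi] using ih i hi
    · simp [hi]

/-- The law of the configuration sampled sequentially. -/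
lemma pexp_seqSol {α : Type*} [Fintype α] (w : α → ℝ) (τ : Fin n → α → (Fin n → Bool) → Bool)
    (hτ : ∀ j a ω ω', (∀ i < j, ω i = ω' i) → τ j a ω = τ j a ω') (F : (Fin n → Bool) → ℝ) :
    pexp w (fun u => F (seqSol fun i => τ i (u i)))
      = ∑ ω, F ω * ∏ i, ∑ a, if τ i a ω = ω i then w a else 0 := by
  have h1 : ∀ u : Fin n → α, (∏ i, w (u i)) * F (seqSol fun i => τ i (u i))
      = ∑ ω, F ω * ∏ i, if τ i (u i) ω = ω i then w (u i) else 0 := by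
    intro u
    rw [sum_eq_single (seqSol fun i => τ i (u i))]
    · have h2 := (seqSol_eq_iff (T := fun i => τ i (u i)) (fun j => hτ j (u j)) _).1 rfl
      rw [mul_comm]
      congr 1
      exact prod_congr rfl fun i _ => (if_pos (h2 i)).symm
    · intro ω _ hne
      have h2 : ¬ ∀ j, τ j (u j) ω = ω j := fun h =>
        hne ((seqSol_eq_iff (T := fun i => τ i (u i)) (fun j => hτ j (u j)) _).2 h).symm
      push Not at h2
      obtain ⟨j, hj⟩ := h2
      rw [prod_eq_zero (mem_univ j) (if_neg hj), mul_zero]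
    · simp
  unfold pexp
  rw [sum_congr rfl fun u _ => h1 u, sum_comm]
  refine sum_congr rfl fun ω _ => ?_
  rw [← mul_sum, prod_univ_sum, Fintype.piFinset_univ]

/-- The mass of the configurations that agree with `ω` below `j` and equal `b` at `j`. -/
def cylMass (q : (Fin n → Bool) → ℝ) (j : Fin n) (ω : Fin n → Bool) (b : Bool) : ℝ :=
  ∑ η, if (∀ i < j, η i = ω i) ∧ η j = b then q η else 0

/-- The conditional probability that coordinate `j` is `true` given the coordinates below it. -/
noncomputable def condProb (q : (Fin n → Bool) → ℝ) (j : Fin n) (ω : Fin n → Bool) : ℝ :=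
  cylMass q j ω true / (cylMass q j ω true + cylMass q j ω false)

lemma cylMass_pos {q : (Fin n → Bool) → ℝ} (hq : ∀ ω, 0 < q ω) (j : Fin n) (ω : Fin n → Bool)
    (b : Bool) : 0 < cylMass q j ω b := by
  refine sum_pos' (fun η _ => ?_) ⟨Function.update ω j b, mem_univ _, ?_⟩
  · split_ifs
    exacts [(hq η).le, le_rfl]
  · rw [if_pos]
    · exact hq _
    · exact ⟨fun i hi => Function.update_of_ne hi.ne _ _, Function.update_self _ _ _⟩

lemma condProb_pos {q : (Fin n → Bool) → ℝ} (hq : ∀ ω, 0 < q ω) (j : Fin n) (ω : Fin n → Bool) :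
    0 < condProb q j ω :=
  div_pos (cylMass_pos hq j ω _) (add_pos (cylMass_pos hq j ω _) (cylMass_pos hq j ω _))

lemma one_sub_condProb {q : (Fin n → Bool) → ℝ} (hq : ∀ ω, 0 < q ω) (j : Fin n)
    (ω : Fin n → Bool) :
    1 - condProb q j ω = cylMass q j ω false / (cylMass q j ω true + cylMass q j ω false) := by
  have := add_pos (cylMass_pos hq j ω true) (cylMass_pos hq j ω false)
  unfold condProb
  field_simp
  ring

lemma condProb_lt_one {q : (Fin n → Bool) → ℝ} (hq : ∀ ω, 0 < q ω) (j : Fin n)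
    (ω : Fin n → Bool) : condProb q j ω < 1 := by
  have h := one_sub_condProb hq j ω
  have := div_pos (cylMass_pos hq j ω false)
    (add_pos (cylMass_pos hq j ω true) (cylMass_pos hq j ω false))
  linarith

lemma condProb_congr (q : (Fin n → Bool) → ℝ) (j : Fin n) (ω ω' : Fin n → Bool)
    (h : ∀ i < j, ω i = ω' i) : condProb q j ω = condProb q j ω' := by
  have : ∀ b, cylMass q j ω b = cylMass q j ω' b := by
    intro b
    refine sum_congr rfl fun η _ => ?_
    congr 1
    refine propext (and_congr_left fun _ => forall₂_congr fun i hi => ?_)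
    rw [h i hi]
  simp only [condProb, this]

lemma condProb_mono {q : (Fin n → Bool) → ℝ} (hq : ∀ ω, 0 < q ω)
    (hfkg : ∀ a b, q a * q b ≤ q (a ⊓ b) * q (a ⊔ b)) (j : Fin n) :
    Monotone (condProb q j) := by
  intro ω ω' hle
  have key : cylMass q j ω true * cylMass q j ω' false
      ≤ cylMass q j ω false * cylMass q j ω' true := by
    have nn : ∀ (ω : Fin n → Bool) (b : Bool),
        0 ≤ fun η => if (∀ i < j, η i = ω i) ∧ η j = b then q η else 0 := by
      intro ω b η
      dsimp only [Pi.zero_apply]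
      split_ifs
      exacts [(hq η).le, le_rfl]
    refine four_functions_theorem_univ _ _ _ _ (nn ω true) (nn ω' false) (nn ω false)
      (nn ω' true) ?_
    intro a b
    by_cases ha : (∀ i < j, a i = ω i) ∧ a j = true
    · by_cases hb : (∀ i < j, b i = ω' i) ∧ b j = false
      · rw [if_pos ha, if_pos hb, if_pos, if_pos]
        · exact hfkg a b
        · refine ⟨fun i hi => ?_, ?_⟩
          · rw [Pi.sup_apply, ha.1 i hi, hb.1 i hi]
            exact sup_eq_right.2 (hle i)
          · rw [Pi.sup_apply, ha.2, hb.2]; rfl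
        · refine ⟨fun i hi => ?_, ?_⟩
          · rw [Pi.inf_apply, ha.1 i hi, hb.1 i hi]
            exact inf_eq_left.2 (hle i)
          · rw [Pi.inf_apply, ha.2, hb.2]; rfl
      · rw [if_neg hb, mul_zero]
        exact mul_nonneg (nn ω false _) (nn ω' true _)
    · rw [if_neg ha, zero_mul]
      exact mul_nonneg (nn ω false _) (nn ω' true _)
  have p := cylMass_pos hq j
  unfold condProb
  rw [div_le_div_iff₀ (add_pos (p _ _) (p _ _)) (add_pos (p _ _) (p _ _))]
  linarith

/-- The chain rule for conditional probabilities. -/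
lemma prod_condProb {q : (Fin n → Bool) → ℝ} (hq : ∀ ω, 0 < q ω) (hsum : ∑ ω, q ω = 1)
    (ω : Fin n → Bool) :
    ∏ i, (if ω i = true then condProb q i ω else 1 - condProb q i ω) = q ω := by
  let M : ℕ → ℝ := fun k => ∑ η, if ∀ i : Fin n, i.val < k → η i = ω i then q η else 0
  have hM : ∀ k, 0 < M k := fun k => by
    refine sum_pos' (fun η _ => ?_) ⟨ω, mem_univ _, ?_⟩
    · split_ifs
      exacts [(hq η).le, le_rfl]
    · rw [if_pos fun _ _ => rfl]
      exact hq ω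
  have h1 : ∀ i : Fin n, cylMass q i ω true + cylMass q i ω false = M i.val := by
    intro i
    unfold cylMass
    rw [← sum_add_distrib]
    refine sum_congr rfl fun η _ => ?_
    have hiff : (∀ l < i, η l = ω l) ↔ ∀ l : Fin n, l.val < i.val → η l = ω l := Iff.rfl
    by_cases h : ∀ l < i, η l = ω l
    · rw [if_pos (hiff.1 h)]
      cases hη : η i
      · rw [if_neg (fun h' => Bool.false_ne_true h'.2), if_pos ⟨h, rfl⟩, zero_add]
      · rw [if_pos ⟨h, rfl⟩, if_neg (fun h' => Bool.false_ne_true h'.2.symm), add_zero]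
    · rw [if_neg (fun h' => h h'.1), if_neg (fun h' => h h'.1), if_neg (fun h' => h (hiff.2 h')),
        add_zero]
  have h2 : ∀ i : Fin n, cylMass q i ω (ω i) = M (i.val + 1) := by
    intro i
    refine sum_congr rfl fun η _ => ?_
    congr 1
    refine propext ⟨fun h l hl => ?_, fun h => ⟨fun l hl => h l ?_, h i (Nat.lt_succ_self _)⟩⟩
    · rcases (Nat.lt_succ_iff.1 hl).eq_or_lt with h3 | h3
      · rw [Fin.ext h3]; exact h.2
      · exact h.1 l h3
    · exact Nat.lt_succ_of_lt hl
  have h3 : ∀ i : Fin n, (if ω i = true then condProb q i ω else 1 - condProb q i ω)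
      = M (i.val + 1) / M i.val := by
    intro i
    rw [← h1 i, ← h2 i]
    cases h : ω i
    · rw [if_neg (by simp), one_sub_condProb hq]
    · rw [if_pos rfl]; rfl
  have htel : ∀ k, ∏ i ∈ range k, M (i + 1) / M i = M k / M 0 := by
    intro k
    induction k with
    | zero => rw [prod_range_zero, div_self (hM 0).ne']
    | succ k ih =>
      have := (hM k).ne'
      rw [prod_range_succ, ih]
      field_simp
  rw [prod_congr rfl fun i _ => h3 i, Fin.prod_univ_eq_prod_range (fun k => M (k + 1) / M k),
    htel]
  have h4 : M n = q ω := by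
    have : ∀ η : Fin n → Bool, (∀ i : Fin n, i.val < n → η i = ω i) ↔ η = ω :=
      fun η => ⟨fun h => funext fun i => h i i.2, fun h i _ => congrFun h i⟩
    simp only [M, this, sum_ite_eq', mem_univ, if_true]
  have h5 : M 0 = 1 := by simpa [M] using hsum
  rw [h4, h5, div_one]

end SequentialSampling

section InfluenceOnCube

open Finset

variable {n : ℕ}

/-- Under a positively associated measure, conditioning on a coordinate increases the probability
of an increasing event more than forcing that coordinate in the sequential sampling. -/
lemma sum_forced_true_le {q : (Fin n → Bool) → ℝ} (hq : ∀ ω, 0 < q ω)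
    (hfkg : ∀ a b, q a * q b ≤ q (a ⊓ b) * q (a ⊔ b)) {F : (Fin n → Bool) → ℝ} (hF0 : 0 ≤ F)
    (hF : Monotone F) (j : Fin n)
    (hone : ∑ ω, (if ω j = true then q ω else 0) * (condProb q j ω)⁻¹ = 1) :
    (∑ ω, if ω j = true then q ω else 0) *
        ∑ ω, (if ω j = true then q ω else 0) * (F ω * (condProb q j ω)⁻¹)
      ≤ ∑ ω, (if ω j = true then q ω else 0) * F ω := by
  obtain ⟨c, hc⟩ : ∃ c : ℝ, ∀ ω, (condProb q j ω)⁻¹ ≤ c :=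
    ⟨∑ ω, (condProb q j ω)⁻¹, fun ω => single_le_sum
      (fun ω _ => (inv_pos.2 (condProb_pos hq j ω)).le) (mem_univ ω)⟩
  set μ : (Fin n → Bool) → ℝ := fun ω => if ω j = true then q ω else 0 with hμdef
  have hμ0 : 0 ≤ μ := fun ω => by
    dsimp only [μ, Pi.zero_apply]
    split_ifs
    exacts [(hq ω).le, le_rfl]
  have hμ : ∀ a b, μ a * μ b ≤ μ (a ⊓ b) * μ (a ⊔ b) := by
    intro a b
    by_cases ha : a j = true
    · by_cases hb : b j = true
      · simp only [μ, Pi.inf_apply, Pi.sup_apply, ha, hb, inf_idem, sup_idem, if_true]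
        exact hfkg a b
      · have : μ b = 0 := if_neg hb
        rw [this, mul_zero]
        exact mul_nonneg (hμ0 _) (hμ0 _)
    · have : μ a = 0 := if_neg ha
      rw [this, zero_mul]
      exact mul_nonneg (hμ0 _) (hμ0 _)
  have hG : Monotone fun ω => c - (condProb q j ω)⁻¹ := fun a b hab =>
    sub_le_sub_left (inv_anti₀ (condProb_pos hq j a) (condProb_mono hq hfkg j hab)) c
  have h := fkg F (fun ω => c - (condProb q j ω)⁻¹) μ hμ0 hF0 (fun ω => sub_nonneg.2 (hc ω)) hF hG
    hμ
  have e1 : ∑ ω, μ ω * (c - (condProb q j ω)⁻¹) = c * ∑ ω, μ ω - 1 := by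
    rw [← hone, mul_sum, ← sum_sub_distrib]
    exact sum_congr rfl fun ω _ => by ring
  have e2 : ∑ ω, μ ω * (F ω * (c - (condProb q j ω)⁻¹))
      = c * ∑ ω, μ ω * F ω - ∑ ω, μ ω * (F ω * (condProb q j ω)⁻¹) := by
    rw [mul_sum, ← sum_sub_distrib]
    exact sum_congr rfl fun ω _ => by ring
  rw [e1, e2] at h
  linarith

lemma le_sum_forced_false {q : (Fin n → Bool) → ℝ} (hq : ∀ ω, 0 < q ω)
    (hfkg : ∀ a b, q a * q b ≤ q (a ⊓ b) * q (a ⊔ b)) {F : (Fin n → Bool) → ℝ} (hF0 : 0 ≤ F)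
    (hF : Monotone F) (j : Fin n)
    (hone : ∑ ω, (if ω j = false then q ω else 0) * (1 - condProb q j ω)⁻¹ = 1) :
    ∑ ω, (if ω j = false then q ω else 0) * F ω
      ≤ (∑ ω, if ω j = false then q ω else 0) *
        ∑ ω, (if ω j = false then q ω else 0) * (F ω * (1 - condProb q j ω)⁻¹) := by
  have hpos : ∀ ω, 0 < 1 - condProb q j ω := fun ω => sub_pos.2 (condProb_lt_one hq j ω)
  set μ : (Fin n → Bool) → ℝ := fun ω => if ω j = false then q ω else 0 with hμdef
  have hμ0 : 0 ≤ μ := fun ω => by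
    dsimp only [μ, Pi.zero_apply]
    split_ifs
    exacts [(hq ω).le, le_rfl]
  have hμ : ∀ a b, μ a * μ b ≤ μ (a ⊓ b) * μ (a ⊔ b) := by
    intro a b
    by_cases ha : a j = false
    · by_cases hb : b j = false
      · simp only [μ, Pi.inf_apply, Pi.sup_apply, ha, hb, inf_idem, sup_idem, if_true]
        exact hfkg a b
      · have : μ b = 0 := if_neg hb
        rw [this, mul_zero]
        exact mul_nonneg (hμ0 _) (hμ0 _)
    · have : μ a = 0 := if_neg ha
      rw [this, zero_mul]
      exact mul_nonneg (hμ0 _) (hμ0 _)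
  have hG : Monotone fun ω => (1 - condProb q j ω)⁻¹ := fun a b hab =>
    inv_anti₀ (hpos b) (sub_le_sub_left (condProb_mono hq hfkg j hab) 1)
  have h := fkg F (fun ω => (1 - condProb q j ω)⁻¹) μ hμ0 hF0 (fun ω => (inv_pos.2 (hpos ω)).le)
    hF hG hμ
  rwa [hone, mul_one] at h

lemma le_of_variance_bound {V δ : ℝ} (hn : 0 < n) (hV1 : V ≤ 1) (hδ : 0 ≤ δ)
    (h : V * (Real.log (√n) + 1) ≤ 4 * (n * δ) + √n * (n * δ ^ 2)) :
    1 / 16 * (V * Real.log n / n) ≤ δ := by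
  by_contra! hlt
  have hn' : (0 : ℝ) < n := Nat.cast_pos.2 hn
  have hL : 0 ≤ Real.log n := Real.log_natCast_nonneg n
  have hpos : 0 < V * Real.log n := by
    by_contra! hcon
    have : V * Real.log n / n ≤ 0 := div_nonpos_of_nonpos_of_nonneg hcon hn'.le
    linarith
  have hV : 0 < V := pos_of_mul_pos_left hpos hL
  have h1 : n * δ ≤ 1 / 16 * (V * Real.log n) := by
    have := mul_le_mul_of_nonneg_left hlt.le hn'.le
    have e : (n : ℝ) * (1 / 16 * (V * Real.log n / n)) = 1 / 16 * (V * Real.log n) := by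
      field_simp
    linarith
  have hs : 0 < √(n : ℝ) := Real.sqrt_pos.2 hn'
  have hlog : Real.log n ≤ 4 * √√(n : ℝ) := by
    have h2 := Real.log_le_sub_one_of_pos (Real.sqrt_pos.2 hs)
    rw [Real.log_sqrt hs.le, Real.log_sqrt hn'.le] at h2
    linarith
  have hlog2 : Real.log n ^ 2 ≤ 16 * √(n : ℝ) := by
    have h3 := pow_le_pow_left₀ hL hlog 2
    rw [mul_pow, Real.sq_sqrt hs.le] at h3
    linarith
  have h4 : √(n : ℝ) * (n * δ ^ 2) ≤ V ^ 2 / 16 := by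
    have h5 : (n * δ) ^ 2 ≤ (1 / 16 * (V * Real.log n)) ^ 2 :=
      pow_le_pow_left₀ (by positivity) h1 2
    have h6 : √(n : ℝ) * (√(n : ℝ) * (n * δ ^ 2)) = (n * δ) ^ 2 := by
      rw [← mul_assoc, Real.mul_self_sqrt hn'.le]
      ring
    have h7 : (1 / 16 * (V * Real.log n)) ^ 2 ≤ √(n : ℝ) * (V ^ 2 / 16) := by
      have := mul_le_mul_of_nonneg_left hlog2 (sq_nonneg V)
      nlinarith
    exact le_of_mul_le_mul_left ((h6.le.trans h5).trans h7) hs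
  rw [Real.log_sqrt hn'.le] at h
  nlinarith

/-- The conditional influence of coordinate `j`, in terms of the weights `q`. -/
noncomputable def cubeInfluence (q F : (Fin n → Bool) → ℝ) (j : Fin n) : ℝ :=
  (∑ ω, (if ω j = true then q ω else 0) * F ω) / (∑ ω, if ω j = true then q ω else 0)
    - (∑ ω, (if ω j = false then q ω else 0) * F ω) / (∑ ω, if ω j = false then q ω else 0)

lemma sum_coord_pos {q : (Fin n → Bool) → ℝ} (hq : ∀ ω, 0 < q ω) (j : Fin n) (b : Bool) :
    0 < ∑ ω, if ω j = b then q ω else 0 := by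
  refine sum_pos' (fun η _ => ?_) ⟨fun _ => b, mem_univ _, ?_⟩
  · split_ifs
    exacts [(hq η).le, le_rfl]
  · rw [if_pos rfl]
    exact hq _

/-- The law of the sequential sampling in which coordinate `j` is forced to be `b`. -/
lemma prod_forced {q : (Fin n → Bool) → ℝ} (hq : ∀ ω, 0 < q ω) (hsum : ∑ ω, q ω = 1)
    (j : Fin n) (b : Bool) (ω : Fin n → Bool) :
    ∏ i, (if i = j then (if b = ω i then (1 : ℝ) else 0)
        else if ω i = true then condProb q i ω else 1 - condProb q i ω)
      = (if ω j = b then q ω else 0)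
        * (if b = true then condProb q j ω else 1 - condProb q j ω)⁻¹ := by
  have hp : ∀ i, (if ω i = true then condProb q i ω else 1 - condProb q i ω) ≠ 0 := by
    intro i
    split_ifs
    exacts [(condProb_pos hq i ω).ne', (sub_pos.2 (condProb_lt_one hq i ω)).ne']
  rw [← mul_prod_erase _ _ (mem_univ j), if_pos rfl]
  by_cases hb : b = ω j
  · subst hb
    rw [if_pos rfl, if_pos rfl, ← prod_condProb hq hsum ω, ← mul_prod_erase _ _ (mem_univ j),
      one_mul, mul_comm, ← mul_assoc, inv_mul_cancel₀ (hp j), one_mul]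
    exact prod_congr rfl fun i hi => if_neg (ne_of_mem_erase hi)
  · rw [if_neg hb, if_neg (fun h => hb h.symm), zero_mul, zero_mul]

lemma absDev_le_one {α : Type*} [Fintype α] {w : α → ℝ} (hw0 : ∀ a, 0 ≤ w a) (hw : ∑ a, w a = 1)
    {g : α → ℝ} (hg : ∀ a, g a = 0 ∨ g a = 1) : absDev w g ≤ 1 := by
  have hg0 : ∀ a, 0 ≤ g a ∧ g a ≤ 1 := fun a => by rcases hg a with h | h <;> rw [h] <;> norm_num
  have h0 : 0 ≤ ∑ b, w b * g b := sum_nonneg fun b _ => mul_nonneg (hw0 b) (hg0 b).1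
  have h1 : ∑ b, w b * g b ≤ 1 := by
    rw [← hw]
    exact sum_le_sum fun b _ => mul_le_of_le_one_right (hw0 b) (hg0 b).2
  unfold absDev
  rw [← hw]
  refine sum_le_sum fun a _ => mul_le_of_le_one_right (hw0 a) ?_
  rw [abs_le]
  constructor <;> linarith [(hg0 a).1, (hg0 a).2]

lemma absDev_of_const {α : Type*} [Fintype α] {w : α → ℝ} (hw : ∑ a, w a = 1)
    {g : α → ℝ} {c : ℝ} (hg : ∀ a, g a = c) : absDev w g = 0 := by
  simp [absDev, hg, ← sum_mul, hw]

lemma energy_of_const {α : Type*} [Fintype α] (k : α → α → ℝ)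
    {g : α → ℝ} {c : ℝ} (hg : ∀ a, g a = c) : energy k g = 0 := by
  simp [energy, hg]

/-- The influence theorem for positive weights on the cube satisfying the FKG lattice condition. -/
theorem cube_influence_theorem {q : (Fin n → Bool) → ℝ} (hn : 0 < n) (hq : ∀ ω, 0 < q ω)
    (hsum : ∑ ω, q ω = 1) (hfkg : ∀ a b, q a * q b ≤ q (a ⊓ b) * q (a ⊔ b))
    {F : (Fin n → Bool) → ℝ} (hF01 : ∀ ω, F ω = 0 ∨ F ω = 1) (hF : Monotone F) {δ : ℝ}
    (hδ : ∀ j, cubeInfluence q F j ≤ δ) :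
    1 / 16 * ((∑ ω, q ω * F ω) * (1 - ∑ ω, q ω * F ω) * Real.log n / n) ≤ δ := by
  have hF0 : 0 ≤ F := fun ω => by
    rcases hF01 ω with h | h <;> rw [h] <;> norm_num
  -- The common chain carrying the uniform variables.
  let S : Finset ℝ := insert 1 (univ.image fun z : Fin n × (Fin n → Bool) => condProb q z.1 z.2)
  have hS : ∀ p ∈ S, 0 < p := by
    intro p hp
    rcases mem_insert.1 hp with rfl | hp
    · exact one_pos
    · obtain ⟨z, -, rfl⟩ := mem_image.1 hp
      exact condProb_pos hq _ _
  have hS1 : ∀ p ∈ S, p ≤ 1 := by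
    intro p hp
    rcases mem_insert.1 hp with rfl | hp
    · exact le_rfl
    · obtain ⟨z, -, rfl⟩ := mem_image.1 hp
      exact (condProb_lt_one hq _ _).le
  have hmem : ∀ j ω, condProb q j ω ∈ S := fun j ω =>
    mem_insert_of_mem (mem_image.2 ⟨(j, ω), mem_univ _, rfl⟩)
  obtain ⟨w', hw', hwsum'⟩ := exists_weights S hS
  let w : S → ℝ := fun a => w' a
  have hwpos : ∀ a, 0 < w a := fun a => hw' a
  have hw0 : ∀ a, 0 ≤ w a := fun a => (hwpos a).le
  have hwp : ∀ p ∈ S, (∑ a : S, if (a : ℝ) ≤ p then w a else 0) = p := by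
    intro p hp
    rw [sum_coe_sort S fun a => if a ≤ p then w' a else 0, ← sum_filter]
    exact hwsum' p hp
  have hw : ∑ a, w a = 1 := by
    rw [← hwp 1 (mem_insert_self _ _)]
    exact sum_congr rfl fun a _ => (if_pos (hS1 a a.2)).symm
  obtain ⟨k, hk, hlsi, hkm, -⟩ := exists_kernel_on w hwpos univ
  rw [hw, mul_one] at hkm
  -- The sampling rules, without and with a forced coordinate.
  let τ : Fin n → S → (Fin n → Bool) → Bool := fun i a ω => decide ((a : ℝ) ≤ condProb q i ω)
  let σ : Fin n → Bool → Fin n → S → (Fin n → Bool) → Bool :=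
    fun j b i a ω => if i = j then b else τ i a ω
  have hτloc : ∀ j a ω ω', (∀ i < j, ω i = ω' i) → τ j a ω = τ j a ω' := by
    intro j a ω ω' h
    simp only [τ, condProb_congr q j ω ω' h]
  have hσloc : ∀ j₀ b j a ω ω', (∀ i < j, ω i = ω' i) → σ j₀ b j a ω = σ j₀ b j a ω' := by
    intro j₀ b j a ω ω' h
    simp only [σ, hτloc j a ω ω' h]
  have hτmono : ∀ i a, Monotone (τ i a) := by
    intro i a ω ω' h
    refine Bool.le_iff_imp.2 fun h1 => ?_
    exact decide_eq_true ((of_decide_eq_true h1).trans (condProb_mono hq hfkg i h))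
  have hσmono : ∀ j b i a, Monotone (σ j b i a) := by
    intro j b i a ω ω' h
    by_cases hi : i = j
    · simp [σ, hi]
    · simpa [σ, hi] using hτmono i a h
  have hτanti : ∀ i a a' ω, a ≤ a' → τ i a' ω ≤ τ i a ω := by
    intro i a a' ω h
    refine Bool.le_iff_imp.2 fun h1 => ?_
    exact decide_eq_true (le_trans (Subtype.coe_le_coe.2 h) (of_decide_eq_true h1))
  let f : (Fin n → S) → ℝ := fun u => F (seqSol fun i => τ i (u i))
  let G : Fin n → Bool → (Fin n → S) → ℝ := fun j b u => F (seqSol fun i => σ j b i (u i))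
  have hτsum : ∀ i ω, (∑ a, if τ i a ω = ω i then w a else 0)
      = if ω i = true then condProb q i ω else 1 - condProb q i ω := by
    intro i ω
    have h1 := hwp _ (hmem i ω)
    cases h : ω i
    · simp only [τ, decide_eq_false_iff_not, Bool.false_eq_true, if_false]
      have h2 : ∑ a : S, ((if (a : ℝ) ≤ condProb q i ω then w a else 0)
          + if ¬ (a : ℝ) ≤ condProb q i ω then w a else 0) = 1 := by
        rw [← hw]
        refine sum_congr rfl fun a _ => ?_
        by_cases h3 : (a : ℝ) ≤ condProb q i ω <;> simp [h3]
      rw [sum_add_distrib, h1] at h2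
      linarith
    · simp only [τ, decide_eq_true_eq, if_true]
      exact h1
  have hlaw : ∀ H : (Fin n → Bool) → ℝ,
      pexp w (fun u => H (seqSol fun i => τ i (u i))) = ∑ ω, q ω * H ω := by
    intro H
    rw [pexp_seqSol w τ hτloc]
    refine sum_congr rfl fun ω _ => ?_
    rw [prod_congr rfl fun i _ => hτsum i ω, prod_condProb hq hsum, mul_comm]
  have hlawσ : ∀ (H : (Fin n → Bool) → ℝ) (j : Fin n) (b : Bool),
      pexp w (fun u => H (seqSol fun i => σ j b i (u i)))
        = ∑ ω, (if ω j = b then q ω else 0)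
          * (H ω * (if b = true then condProb q j ω else 1 - condProb q j ω)⁻¹) := by
    intro H j b
    rw [pexp_seqSol w (σ j b) (hσloc j b)]
    refine sum_congr rfl fun ω _ => ?_
    have h1 : ∀ i, (∑ a, if σ j b i a ω = ω i then w a else 0)
        = if i = j then (if b = ω i then (1 : ℝ) else 0)
        else if ω i = true then condProb q i ω else 1 - condProb q i ω := by
      intro i
      by_cases hi : i = j
      · simp only [σ, hi, if_true]
        by_cases hb : b = ω j
        · simpa only [hb, if_true] using hw
        · simp [hb]
      · simp only [σ, hi, if_false]
        exact hτsum i ω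
    rw [prod_congr rfl fun i _ => h1 i, prod_forced hq hsum]
    ring
  have hJ : ∀ j, pexp w (fun u => G j true u - G j false u) ≤ δ := by
    intro j
    refine le_trans ?_ (hδ j)
    rw [pexp_sub]
    have t1 := hlawσ (fun _ => 1) j true
    have t2 := hlawσ (fun _ => 1) j false
    simp only [pexp_const hw, one_mul, if_true, Bool.false_eq_true, if_false] at t1 t2
    have s1 := sum_forced_true_le hq hfkg hF0 hF j t1.symm
    have s2 := le_sum_forced_false hq hfkg hF0 hF j t2.symm
    have g1 := hlawσ F j true
    have g2 := hlawσ F j false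
    simp only [if_true, Bool.false_eq_true, if_false] at g1 g2
    rw [← g1] at s1
    rw [← g2] at s2
    unfold cubeInfluence
    refine sub_le_sub ?_ ?_
    · rw [le_div_iff₀ (sum_coord_pos hq j true), mul_comm]
      exact s1
    · rw [div_le_iff₀ (sum_coord_pos hq j false), mul_comm]
      exact s2
  have hfib : ∀ j u, (∀ a, G j false u ≤ f (Function.update u j a)) ∧
      ∀ a, f (Function.update u j a) ≤ G j true u := by
    intro j u
    constructor
    · intro a
      refine hF (seqSol_mono (fun i => hτmono i _) fun i ω => ?_)
      by_cases hi : i = j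
      · simp [σ, hi]
      · simp [σ, hi]
    · intro a
      refine hF (seqSol_mono (fun i => hσmono j true i _) fun i ω => ?_)
      by_cases hi : i = j
      · simp [σ, hi, Bool.le_true]
      · simp [σ, hi]
  have hfanti : ∀ j u, Antitone fun a => f (Function.update u j a) := by
    intro j u a a' h
    refine hF (seqSol_mono (fun i => hτmono i _) fun i ω => ?_)
    by_cases hi : i = j
    · subst hi
      simpa using hτanti i a a' ω h
    · simp [hi]
  have hbound : ∀ j u, energy k (fun a => f (Function.update u j a))
        ≤ 4 * (G j true u - G j false u) ∧
      absDev w (fun a => f (Function.update u j a)) ≤ G j true u - G j false u := by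
    intro j u
    have hf01 : ∀ a, f (Function.update u j a) = 0 ∨ f (Function.update u j a) = 1 :=
      fun a => hF01 _
    have hb := hfib j u
    rcases hF01 (seqSol fun i => σ j false i (u i)) with h0 | h0 <;>
      rcases hF01 (seqSol fun i => σ j true i (u i)) with h1 | h1 <;>
      change G j _ u = _ at h0 <;> change G j _ u = _ at h1 <;> rw [h0, h1] at hb ⊢
    · have hc : ∀ a, f (Function.update u j a) = 0 := fun a => le_antisymm (hb.2 a) (hb.1 a)
      rw [energy_of_const k hc, absDev_of_const hw hc]
      norm_num
    · rw [sub_zero, mul_one]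
      exact ⟨hkm _ hf01 (hfanti j u), absDev_le_one hw0 hw hf01⟩
    · linarith [hb.1 (u j), hb.2 (u j)]
    · have hc : ∀ a, f (Function.update u j a) = 1 := fun a => le_antisymm (hb.2 a) (hb.1 a)
      rw [energy_of_const k hc, absDev_of_const hw hc]
      norm_num
  have hE : ∀ j, pexp w (fun u => energy k (fun a => f (Function.update u j a))) ≤ 4 * δ := by
    intro j
    refine (pexp_mono hw0 fun u => (hbound j u).1).trans ?_
    rw [pexp_mul_left]
    exact mul_le_mul_of_nonneg_left (hJ j) (by norm_num)
  have hD : ∀ j, pexp w (fun u => absDev w (fun a => f (Function.update u j a))) ≤ δ :=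
    fun j => (pexp_mono hw0 fun u => (hbound j u).2).trans (hJ j)
  have hD0 : ∀ j, 0 ≤ pexp w (fun u => absDev w (fun a => f (Function.update u j a))) :=
    fun j => pexp_nonneg hw0 fun u => sum_nonneg fun a _ => mul_nonneg (hw0 a) (abs_nonneg _)
  have hδ0 : 0 ≤ δ := (hD0 ⟨0, hn⟩).trans (hD ⟨0, hn⟩)
  have hmain := variance_mul_log_le hw0 hw hk hlsi f
    (Real.sqrt_pos.2 (Nat.cast_pos.2 hn : (0 : ℝ) < n))
  have hff : ∀ u, f u ^ 2 = f u := by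
    intro u
    rcases hF01 (seqSol fun i => τ i (u i)) with h | h <;> simp [f, h]
  have hfe : pexp w f = ∑ ω, q ω * F ω := hlaw F
  simp only [hff] at hmain
  change (pexp w f - pexp w f ^ 2) * _ ≤ _ at hmain
  rw [hfe] at hmain
  have hA0 : 0 ≤ ∑ ω, q ω * F ω := sum_nonneg fun ω _ => mul_nonneg (hq ω).le (hF0 ω)
  have sE := sum_le_sum fun j (_ : j ∈ univ) => hE j
  have sD := sum_le_sum fun j (_ : j ∈ univ) => pow_le_pow_left₀ (hD0 j) (hD j) 2
  simp only [sum_const, card_univ, Fintype.card_fin, nsmul_eq_mul] at sE sD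
  refine le_of_variance_bound hn ?_ hδ0 ?_
  · nlinarith [sq_nonneg ((∑ ω, q ω * F ω) - 1 / 2)]
  · have sD' := mul_le_mul_of_nonneg_left sD (Real.sqrt_nonneg (n : ℝ))
    have e : (∑ ω, q ω * F ω) * (1 - ∑ ω, q ω * F ω)
        = (∑ ω, q ω * F ω) - (∑ ω, q ω * F ω) ^ 2 := by ring
    rw [e]
    linarith

end InfluenceOnCube

lemma toReal_measure_eq_sum {α : Type*} [Fintype α] [MeasurableSpace α]
    [MeasurableSingletonClass α] (Q : Measure α) [IsFiniteMeasure Q] (s : Set α) :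
    (Q s).toReal = ∑ ω, (Q {ω}).toReal * s.indicator 1 ω := by
  classical
  have h : s = ((Finset.univ.filter (· ∈ s) : Finset α) : Set α) := by
    ext ω
    simp
  conv_lhs => rw [h]
  rw [← sum_measure_singleton, ENNReal.toReal_sum fun ω _ => measure_ne_top Q _,
    Finset.sum_filter]
  refine Finset.sum_congr rfl fun ω _ => ?_
  by_cases hω : ω ∈ s <;> simp [hω]

/-- **ℓ^∞ influence theorem** (Theorem 4.1, equation (4.3)): there is a universal constant
`c > 0` such that for every positive probability measure `Q` on `K → Bool` satisfying the
FKG lattice condition and every increasing set `A`,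
`max_x I_Q(A, x) ≥ c · Q(A)(1 − Q(A)) · log|K| / |K|`. -/
theorem influence_theorem_linfty :
    ∃ c : ℝ, 0 < c ∧
      ∀ (K : Type) [Fintype K] [Nonempty K] (Q : Measure (K → Bool)),
        IsProbabilityMeasure Q →
        (∀ ω : K → Bool, 0 < Q {ω}) →
        (∀ ω ω' : K → Bool,
          Q {ω} * Q {ω'} ≤ Q {fun x => ω x || ω' x} * Q {fun x => ω x && ω' x}) →
        ∀ A : Set (K → Bool),
          (∀ ω ω' : K → Bool, ω ∈ A → (∀ x, ω x ≤ ω' x) → ω' ∈ A) →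
          c * ((Q A).toReal * (1 - (Q A).toReal)
              * Real.log (Fintype.card K) / (Fintype.card K))
            ≤ Finset.univ.sup' Finset.univ_nonempty (fun x => condInfluenceBool Q A x) := by
  refine ⟨1 / 16, by norm_num, fun K _ _ Q _ hpos hfkg A hA => ?_⟩
  classical
  let e : K ≃ Fin (Fintype.card K) := Fintype.equivFin K
  let E : (Fin (Fintype.card K) → Bool) ≃ (K → Bool) := e.symm.arrowCongr (Equiv.refl Bool)
  have hE : ∀ ω x, E ω x = ω (e x) := fun ω x => rfl
  have hsum : ∀ s : Set (K → Bool),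
      (Q s).toReal = ∑ ω, (Q {E ω}).toReal * s.indicator 1 (E ω) := by
    intro s
    rw [toReal_measure_eq_sum, E.sum_comp fun ω => (Q {ω}).toReal * s.indicator 1 ω]
  have hq : ∀ ω, 0 < (Q {E ω}).toReal :=
    fun ω => ENNReal.toReal_pos (hpos _).ne' (measure_ne_top Q _)
  have hone : ∑ ω, (Q {E ω}).toReal = 1 := by
    have h := hsum Set.univ
    simp only [measure_univ, ENNReal.toReal_one, Set.indicator_univ, Pi.one_apply, mul_one] at h
    exact h.symm
  have hlat : ∀ a b, (Q {E a}).toReal * (Q {E b}).toReal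
      ≤ (Q {E (a ⊓ b)}).toReal * (Q {E (a ⊔ b)}).toReal := by
    intro a b
    have h := ENNReal.toReal_mono
      (ENNReal.mul_ne_top (measure_ne_top Q _) (measure_ne_top Q _)) (hfkg (E a) (E b))
    rw [ENNReal.toReal_mul, ENNReal.toReal_mul, mul_comm (Q _).toReal (Q {fun x => _ && _}).toReal]
      at h
    exact h
  have hinf : ∀ x, condInfluenceBool Q A x
      = cubeInfluence (fun ω => (Q {E ω}).toReal) (fun ω => A.indicator 1 (E ω)) (e x) := by
    intro x
    have h1 : ∀ b, (Q {ω | ω x = b}).toReal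
        = ∑ ω, if ω (e x) = b then (Q {E ω}).toReal else 0 := by
      intro b
      rw [hsum]
      refine Finset.sum_congr rfl fun ω _ => ?_
      by_cases h : ω (e x) = b <;> simp [hE, h]
    have h2 : ∀ b, (Q (A ∩ {ω | ω x = b})).toReal
        = ∑ ω, (if ω (e x) = b then (Q {E ω}).toReal else 0) * A.indicator 1 (E ω) := by
      intro b
      rw [hsum]
      refine Finset.sum_congr rfl fun ω _ => ?_
      by_cases h : ω (e x) = b <;> simp [Set.indicator_apply, hE, h]
    rw [condInfluenceBool, h1, h1, h2, h2]
    rfl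
  rw [hsum A]
  refine cube_influence_theorem Fintype.card_pos hq hone hlat (fun ω => ?_) (fun a b hab => ?_)
    fun j => ?_
  · by_cases h : E ω ∈ A <;> simp [h]
  · by_cases h : E a ∈ A
    · have h' : E b ∈ A := hA _ _ h fun x => hab (e x)
      simp [h, h']
    · simp only [Set.indicator_of_notMem h]
      exact Set.indicator_nonneg (fun _ _ => zero_le_one) _
  · obtain ⟨x, rfl⟩ := e.surjective j
    rw [← hinf x]
    exact Finset.le_sup' (fun x => condInfluenceBool Q A x) (Finset.mem_univ x)
end
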